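/- arXiv:1006.0529 — 2 statements merged into one kernel-verified Lean document; each statement's English description precedes it below -/
import Mathlib

section
/- Let p = (p_1, …, p_N) be a configuration of points in Euclidean space E^d and r = (r_1, …, r_N) nonnegative radii such that each pair of balls has common points with at most d + 1 of the other balls; i.e., for every pair of indices i < j there are at most d + 1 indices l ∉ {i, j} with B_d(p_i, r_i) ∩ B_d(p_j, r_j) ∩ B_d(p_l, r_l) ≠ ∅. Then for every expansion q = (q_1, …, q_N) of p in E^d, Vol_d[⋃_{i=1}^N B_d(p_i, r_i)] ≤ Vol_d[⋃_{i=1}^N B_d(q_i, r_i)]. -/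
open Metric MeasureTheory


namespace KP
open Finset

variable {ι : Type*} [Fintype ι] [DecidableEq ι]

lemma sum_sq_center {V : Type*} [NormedAddCommGroup V] [InnerProductSpace ℝ V]
    (w : ι → ℝ) (P : ι → V) (x : V) (hw : 0 < ∑ i, w i) :
    ∑ i, w i * ‖x - P i‖ ^ 2 =
      (∑ i, w i) * ‖x - (∑ i, w i)⁻¹ • ∑ i, w i • P i‖ ^ 2 +
        (2 * ∑ i, w i)⁻¹ * ∑ i, ∑ j, w i * w j * ‖P i - P j‖ ^ 2 := by
  set L := ∑ i, w i with hL
  have e1 : ∑ i, w i * ‖x - P i‖ ^ 2 =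
      L * ‖x‖ ^ 2 - 2 * inner ℝ x (∑ i, w i • P i) + ∑ i, w i * ‖P i‖ ^ 2 := by
    simp only [norm_sub_sq_real, inner_sum, inner_smul_right, hL, Finset.sum_mul, Finset.mul_sum]
    rw [← Finset.sum_sub_distrib, ← Finset.sum_add_distrib]
    exact Finset.sum_congr rfl fun i _ => by ring
  have e2 : ∑ i, ∑ j, w i * w j * ‖P i - P j‖ ^ 2 =
      2 * L * (∑ i, w i * ‖P i‖ ^ 2) - 2 * ‖∑ i, w i • P i‖ ^ 2 := by
    rw [← real_inner_self_eq_norm_sq (∑ i, w i • P i)]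
    simp only [sum_inner, inner_sum, inner_smul_right, inner_smul_left, norm_sub_sq_real]
    have : 2 * L * (∑ i, w i * ‖P i‖ ^ 2) =
      ∑ i, ∑ j, (w i * w j * ‖P i‖ ^ 2 + w i * w j * ‖P j‖ ^ 2) := by
      simp only [Finset.sum_add_distrib]
      rw [Finset.sum_comm (f := fun i j => w i * w j * ‖P i‖ ^ 2)]
      have : ∀ j, ∑ i, w i * w j * ‖P i‖ ^ 2 = w j * (∑ i, w i * ‖P i‖ ^ 2) := by
        intro j; rw [Finset.mul_sum]; exact Finset.sum_congr rfl fun i _ => by ring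
      have h2 : ∀ j, ∑ i, w j * w i * ‖P i‖ ^ 2 = w j * (∑ i, w i * ‖P i‖ ^ 2) := by
        intro j; rw [Finset.mul_sum]; exact Finset.sum_congr rfl fun i _ => by ring
      simp only [this, h2, ← Finset.sum_mul]
      rw [← hL]; ring
    rw [this, Finset.mul_sum, ← Finset.sum_sub_distrib]
    refine Finset.sum_congr rfl fun i _ => ?_
    simp only [Finset.mul_sum, conj_trivial]
    rw [← Finset.sum_sub_distrib]
    refine Finset.sum_congr rfl fun j _ => ?_
    rw [real_inner_comm (P i) (P j)]
    ring
  rw [e1, e2, norm_sub_sq_real, inner_smul_right, norm_smul]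
  have : L ≠ 0 := hw.ne'
  rw [mul_pow, Real.norm_eq_abs, sq_abs]
  field_simp
  ring

lemma gauss {n : ℕ} (w : ι → ℝ) (P : ι → EuclideanSpace ℝ (Fin n)) (hw : 0 < ∑ i, w i) :
    Integrable (fun x : EuclideanSpace ℝ (Fin n) => Real.exp (-∑ i, w i * ‖x - P i‖ ^ 2)) ∧
    ∫ x : EuclideanSpace ℝ (Fin n), Real.exp (-∑ i, w i * ‖x - P i‖ ^ 2) =
      (Real.pi / ∑ i, w i) ^ ((n : ℝ) / 2) *
        Real.exp (-((2 * ∑ i, w i)⁻¹ * ∑ i, ∑ j, w i * w j * ‖P i - P j‖ ^ 2)) := by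
  set L := ∑ i, w i with hL
  set c := L⁻¹ • ∑ i, w i • P i
  have e : ∀ x : EuclideanSpace ℝ (Fin n), Real.exp (-∑ i, w i * ‖x - P i‖ ^ 2) =
      Real.exp (-L * ‖x - c‖ ^ 2) *
        Real.exp (-((2 * L)⁻¹ * ∑ i, ∑ j, w i * w j * ‖P i - P j‖ ^ 2)) := by
    intro x
    rw [← Real.exp_add, sum_sq_center w P x hw]
    congr 1; ring
  simp only [e]
  have hint := GaussianFourier.integral_rexp_neg_mul_sq_norm (V := EuclideanSpace ℝ (Fin n)) hw
  have hI : Integrable (fun x : EuclideanSpace ℝ (Fin n) => Real.exp (-L * ‖x‖ ^ 2)) := by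
    by_contra h
    rw [integral_undef h] at hint
    have : 0 < (Real.pi / L) ^ ((Module.finrank ℝ (EuclideanSpace ℝ (Fin n)) : ℝ) / 2) := by
      have := Real.pi_pos
      positivity
    linarith
  constructor
  · exact (hI.comp_sub_right c).mul_const _
  · rw [integral_mul_const, integral_sub_right_eq_self (fun x : EuclideanSpace ℝ (Fin n) => Real.exp (-L * ‖x‖ ^ 2)) c, hint]
    simp

/-- formal Gaussian integral -/
noncomputable def Th (n : ℕ) (a : ℝ) (D : ι → ι → ℝ) (k : ι → ℕ) : ℝ :=
  (Real.pi / (a * ∑ i, (k i : ℝ))) ^ ((n : ℝ) / 2) *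
    Real.exp (-(a * (2 * ∑ i, (k i : ℝ))⁻¹ * ∑ i, ∑ j, (k i : ℝ) * k j * D i j))

/-- formal integral of a product of polynomials in Gaussians -/
noncomputable def H (n : ℕ) (a : ℝ) (M : ℕ) (Q : ι → Polynomial ℝ) (D : ι → ι → ℝ) : ℝ :=
  ∑ k ∈ Fintype.piFinset (fun _ : ι => range M), (∏ i, (Q i).coeff (k i)) * Th n a D k

lemma sum_pos_of_coeff {Q : ι → Polynomial ℝ} {i0 : ι} (h0 : (Q i0).coeff 0 = 0) {k : ι → ℕ}
    (hk : (∏ i, (Q i).coeff (k i)) ≠ 0) : 0 < ∑ i, (k i : ℝ) := by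
  have : k i0 ≠ 0 := by
    intro h
    apply hk
    apply Finset.prod_eq_zero (Finset.mem_univ i0)
    rw [h, h0]
  have h1 : (0 : ℝ) < k i0 := by exact_mod_cast Nat.pos_of_ne_zero this
  exact lt_of_lt_of_le h1 (Finset.single_le_sum (f := fun i => (k i : ℝ)) (fun i _ => by positivity) (Finset.mem_univ i0))

lemma H_integral {n : ℕ} {a : ℝ} (ha : 0 < a) {M : ℕ} {Q : ι → Polynomial ℝ}
    (hM : ∀ i, (Q i).natDegree < M) {i0 : ι} (h0 : (Q i0).coeff 0 = 0) (S : Finset ι)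
    (hS : ∀ i, i ∉ S → Q i = 1) (P : ι → EuclideanSpace ℝ (Fin n)) (D : ι → ι → ℝ)
    (hD : ∀ i ∈ S, ∀ j ∈ S, D i j = ‖P i - P j‖ ^ 2) :
    Integrable (fun x : EuclideanSpace ℝ (Fin n) =>
      ∏ i, (Q i).eval (Real.exp (-(a * ‖x - P i‖ ^ 2)))) ∧
    ∫ x : EuclideanSpace ℝ (Fin n), ∏ i, (Q i).eval (Real.exp (-(a * ‖x - P i‖ ^ 2))) =
      H n a M Q D := by
  have e : ∀ x : EuclideanSpace ℝ (Fin n), ∏ i, (Q i).eval (Real.exp (-(a * ‖x - P i‖ ^ 2))) =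
      ∑ k ∈ Fintype.piFinset (fun _ : ι => range M), (∏ i, (Q i).coeff (k i)) *
        Real.exp (-∑ i, (a * k i) * ‖x - P i‖ ^ 2) := by
    intro x
    have : ∀ i, (Q i).eval (Real.exp (-(a * ‖x - P i‖ ^ 2))) =
        ∑ m ∈ range M, (Q i).coeff m * Real.exp (-(a * m * ‖x - P i‖ ^ 2)) := by
      intro i
      rw [Polynomial.eval_eq_sum_range' (hM i)]
      refine Finset.sum_congr rfl fun m _ => ?_
      rw [← Real.exp_nat_mul]
      congr 2; ring
    simp only [this]
    rw [Finset.prod_univ_sum]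
    refine Finset.sum_congr rfl fun k _ => ?_
    rw [Finset.prod_mul_distrib, ← Real.exp_sum, Finset.sum_neg_distrib]
  have key : ∀ k : ι → ℕ, Integrable (fun x : EuclideanSpace ℝ (Fin n) =>
        (∏ i, (Q i).coeff (k i)) * Real.exp (-∑ i, (a * k i) * ‖x - P i‖ ^ 2)) ∧
      ∫ x : EuclideanSpace ℝ (Fin n), 
        (∏ i, (Q i).coeff (k i)) * Real.exp (-∑ i, (a * k i) * ‖x - P i‖ ^ 2) =
        (∏ i, (Q i).coeff (k i)) * Th n a D k := by
    intro k
    by_cases hk : (∏ i, (Q i).coeff (k i)) = 0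
    · simp [hk]
    have hp := sum_pos_of_coeff h0 hk
    have hp' : 0 < ∑ i, a * (k i : ℝ) := by rw [← Finset.mul_sum]; positivity
    obtain ⟨g1, g2⟩ := gauss (fun i => a * (k i : ℝ)) P hp'
    refine ⟨g1.const_mul _, ?_⟩
    rw [integral_const_mul, g2]
    congr 1
    unfold Th
    rw [← Finset.mul_sum]
    congr 3
    have hz : ∀ i, i ∉ S → k i = 0 := by
      intro i hi
      by_contra hne
      apply hk
      apply Finset.prod_eq_zero (Finset.mem_univ i)
      rw [hS i hi, Polynomial.coeff_one, if_neg hne]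
    have : ∑ i, ∑ j, a * (k i : ℝ) * (a * k j) * ‖P i - P j‖ ^ 2 =
        a ^ 2 * ∑ i, ∑ j, (k i : ℝ) * k j * D i j := by
      rw [Finset.mul_sum]
      refine Finset.sum_congr rfl fun i _ => ?_
      rw [Finset.mul_sum]
      refine Finset.sum_congr rfl fun j _ => ?_
      by_cases hi : i ∈ S
      · by_cases hj : j ∈ S
        · rw [hD i hi j hj]; ring
        · simp [hz j hj]
      · simp [hz i hi]
    rw [this]
    field_simp
  simp only [e]
  constructor
  · exact integrable_finsetSum _ fun k _ => (key k).1
  · rw [integral_finsetSum _ fun k _ => (key k).1]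
    exact Finset.sum_congr rfl fun k _ => (key k).2

/-- the modified family -/
noncomputable def Qd (Q : ι → Polynomial ℝ) (i j : ι) : ι → Polynomial ℝ :=
  fun k => if k = i ∨ k = j then Polynomial.X * Polynomial.derivative (Q k) else Q k

lemma coeff_Qd (Q : ι → Polynomial ℝ) {i j : ι} (hij : i ≠ j) (k : ι → ℕ) :
    ∏ l, (Qd Q i j l).coeff (k l) = (k i : ℝ) * k j * ∏ l, (Q l).coeff (k l) := by
  have : ∀ l, (Qd Q i j l).coeff (k l) =
      (if l = i then (k i : ℝ) else 1) * (if l = j then (k j : ℝ) else 1) * (Q l).coeff (k l) := by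
    intro l
    have hx : ∀ (q : Polynomial ℝ) (m : ℕ), (Polynomial.X * Polynomial.derivative q).coeff m = m * q.coeff m := by
      intro q m
      cases m with
      | zero => simp
      | succ m => rw [Polynomial.coeff_X_mul, Polynomial.coeff_derivative]; push_cast; ring
    unfold Qd
    by_cases h1 : l = i
    · subst h1; simp [hx, hij]
    · by_cases h2 : l = j
      · subst h2; simp [hx, h1]
      · simp [h1, h2]
  simp only [this, Finset.prod_mul_distrib]
  simp

lemma H_deriv {n : ℕ} {a : ℝ} (ha : 0 < a) {M : ℕ} {Q : ι → Polynomial ℝ}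
    {i0 : ι} (h0 : (Q i0).coeff 0 = 0) (D0 E : ι → ι → ℝ) (hE : ∀ i, E i i = 0) (t : ℝ) :
    HasDerivAt (fun t : ℝ => H n a M Q (fun i j => D0 i j + t * E i j))
      (-∑ i, ∑ j, E i j * (a ^ 2 / (2 * Real.pi)) *
        H (n + 2) a M (Qd Q i j) (fun i j => D0 i j + t * E i j)) t := by
  have hterm : ∀ k : ι → ℕ, HasDerivAt (fun t : ℝ => (∏ i, (Q i).coeff (k i)) *
        Th n a (fun i j => D0 i j + t * E i j) k)
      (-∑ i, ∑ j, E i j * (a ^ 2 / (2 * Real.pi)) *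
        ((k i : ℝ) * k j * (∏ l, (Q l).coeff (k l)) *
          Th (n+2) a (fun i j => D0 i j + t * E i j) k)) t := by
    intro k
    by_cases hk : (∏ i, (Q i).coeff (k i)) = 0
    · simp only [hk]; simpa using hasDerivAt_const t (0:ℝ)
    have hp := sum_pos_of_coeff h0 hk
    set L := ∑ i, (k i : ℝ) with hL
    have h1 : HasDerivAt (fun t : ℝ => ∑ i, ∑ j, (k i : ℝ) * k j * (D0 i j + t * E i j))
        (∑ i, ∑ j, (k i : ℝ) * k j * E i j) t := by
      refine HasDerivAt.fun_sum fun i _ => HasDerivAt.fun_sum fun j _ => ?_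
      refine HasDerivAt.const_mul _ (HasDerivAt.const_add _ ?_)
      simpa using (hasDerivAt_id t).mul_const (E i j)
    have h2 := ((((h1.const_mul (a * (2 * L)⁻¹)).neg).exp).const_mul
      ((Real.pi / (a * L)) ^ ((n : ℝ) / 2))).const_mul (∏ i, (Q i).coeff (k i))
    unfold Th
    refine h2.congr_deriv ?_
    have hpow : (Real.pi / (a * L)) ^ (((n + 2 : ℕ) : ℝ) / 2) =
        (Real.pi / (a * L)) ^ ((n : ℝ) / 2) * (Real.pi / (a * L)) := by
      have hpos : 0 < Real.pi / (a * L) := by have := Real.pi_pos; positivity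
      rw [← Real.rpow_add_one hpos.ne']
      congr 1; push_cast; ring
    simp only [← hL, hpow]
    have : ∀ c : ℝ, ∑ i, ∑ j, E i j * (a ^ 2 / (2 * Real.pi)) * ((k i : ℝ) * k j * (∏ l, (Q l).coeff (k l)) * c)
        = (∑ i, ∑ j, (k i : ℝ) * k j * E i j) * ((a ^ 2 / (2 * Real.pi)) * (∏ l, (Q l).coeff (k l)) * c) := by
      intro c
      simp only [Finset.sum_mul]
      refine Finset.sum_congr rfl fun i _ => Finset.sum_congr rfl fun j _ => ?_
      ring
    rw [this]
    have := Real.pi_pos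
    simp only [Pi.neg_apply]
    field_simp
  have := HasDerivAt.fun_sum (u := Fintype.piFinset (fun _ : ι => range M)) fun k _ => hterm k
  refine this.congr_deriv ?_
  rw [Finset.sum_neg_distrib, Finset.sum_comm]
  congr 1
  refine Finset.sum_congr rfl fun i _ => ?_
  rw [Finset.sum_comm]
  refine Finset.sum_congr rfl fun j _ => ?_
  by_cases hij : i = j
  · subst hij; simp [hE]
  · unfold H
    rw [Finset.mul_sum]
    refine Finset.sum_congr rfl fun k _ => ?_
    rw [coeff_Qd Q hij]

end KP

namespace KP
open Finset
variable {ι : Type*} [Fintype ι] [DecidableEq ι]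

lemma sq_max_le (s t : ℝ) : (max t 0) ^ 2 ≤ (max s 0) ^ 2 + 2 * max s 0 * (t - s) + (t - s) ^ 2 := by
  rcases le_total s 0 with hs | hs <;> rcases le_total t 0 with ht | ht <;> simp [hs, ht] <;> nlinarith

lemma kirsz {d : ℕ} (S : Finset ι) (p : ι → EuclideanSpace ℝ (Fin d)) (c : ι → ℝ)
    (h : ∀ x, ∃ k ∈ S, c k < ‖x - p k‖ ^ 2) :
    ∃ δ : ℝ, 0 < δ ∧ ∀ (m : ℕ) (q : ι → EuclideanSpace ℝ (Fin m)),
      (∀ i ∈ S, ∀ j ∈ S, ‖p i - p j‖ ^ 2 ≤ ‖q i - q j‖ ^ 2) → ∀ y, ∃ k ∈ S, δ ≤ ‖y - q k‖ ^ 2 - c k := by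
  obtain ⟨k0, hk0, -⟩ := h 0
  set v : EuclideanSpace ℝ (Fin d) → ι → ℝ := fun x k => ‖x - p k‖ ^ 2 - c k with hv
  set φ : EuclideanSpace ℝ (Fin d) → ℝ := fun x => ∑ k ∈ S, (max (v x k) 0) ^ 2 with hφ
  have hcont : Continuous φ := by
    simp only [hφ, hv]; fun_prop
  have hlim : Filter.Tendsto φ (Filter.cocompact _) Filter.atTop := by
    have h1 : Filter.Tendsto (fun x : EuclideanSpace ℝ (Fin d) => dist x (p k0)) (Filter.cocompact _) Filter.atTop :=
      tendsto_dist_right_cocompact_atTop (p k0)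
    have h2 : Filter.Tendsto (fun x : ℝ => (max (x ^ 2 - c k0) 0) ^ 2) Filter.atTop Filter.atTop := by
      have h3 : Filter.Tendsto (fun x : ℝ => x ^ 2 - c k0) Filter.atTop Filter.atTop :=
        Filter.tendsto_atTop_add_const_right _ _ (Filter.tendsto_pow_atTop two_ne_zero)
      exact (Filter.tendsto_pow_atTop two_ne_zero).comp
        (Filter.tendsto_atTop_mono (fun x => le_max_left _ _) h3)
    refine Filter.tendsto_atTop_mono (fun x => ?_) (h2.comp h1)
    simp only [Function.comp, dist_eq_norm]
    exact Finset.single_le_sum (f := fun k => (max (v x k) 0) ^ 2) (fun k _ => by positivity) hk0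
  obtain ⟨x0, hx0⟩ := hcont.exists_forall_le hlim
  set s : ι → ℝ := fun k => if k ∈ S then max (v x0 k) 0 else 0 with hs
  have hs0 : ∀ k, 0 ≤ s k := by
    intro k; simp only [hs]; split_ifs <;> simp
  have hsS : ∀ k ∈ S, s k = max (v x0 k) 0 := fun k hk => by simp [hs, hk]
  have hsn : ∀ k, k ∉ S → s k = 0 := fun k hk => by simp [hs, hk]
  have hpos : ∃ k ∈ S, 0 < s k := by
    obtain ⟨k, hk, hlt⟩ := h x0
    refine ⟨k, hk, ?_⟩
    rw [hsS k hk]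
    exact lt_max_of_lt_left (by simp only [hv]; linarith)
  set g : EuclideanSpace ℝ (Fin d) := ∑ k ∈ S, s k • (x0 - p k) with hg
  have hg0 : g = 0 := by
    set Δ : ι → ℝ → ℝ := fun k e => e * (-2 * inner ℝ g (x0 - p k)) + e ^ 2 * ‖g‖ ^ 2 with hΔ
    set ψ : ℝ → ℝ := fun e => ∑ k ∈ S, ((s k) ^ 2 + 2 * s k * Δ k e + (Δ k e) ^ 2) with hψ
    have hmin : IsLocalMin ψ 0 := by
      refine Filter.Eventually.of_forall fun e => ?_
      have h1 : ψ 0 = φ x0 := by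
        simp only [hψ, hφ, hΔ]
        refine Finset.sum_congr rfl fun k hk => ?_
        rw [hsS k hk]; simp
      rw [h1]
      refine (hx0 (x0 - e • g)).trans ?_
      refine Finset.sum_le_sum fun k hk => ?_
      refine (sq_max_le (v x0 k) _).trans (le_of_eq ?_)
      have : v (x0 - e • g) k - v x0 k = Δ k e := by
        simp only [hv, hΔ]
        have : x0 - e • g - p k = (x0 - p k) - e • g := by abel
        rw [this, norm_sub_sq_real (x0 - p k), inner_smul_right, norm_smul, mul_pow, Real.norm_eq_abs, sq_abs,
          real_inner_comm]
        ring
      rw [this, hsS k hk]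
    have hder : HasDerivAt ψ (∑ k ∈ S, 2 * s k * (-2 * inner ℝ g (x0 - p k))) 0 := by
      refine HasDerivAt.fun_sum fun k _ => ?_
      have hd : HasDerivAt (Δ k) (-2 * inner ℝ g (x0 - p k)) 0 := by
        have := ((hasDerivAt_id (0:ℝ)).mul_const (-2 * inner ℝ g (x0 - p k))).add
          (((hasDerivAt_id (0:ℝ)).pow 2).mul_const (‖g‖ ^ 2))
        refine this.congr_deriv ?_
        simp
      have := ((hd.const_mul (2 * s k)).const_add (s k ^ 2)).add (hd.pow 2)
      refine this.congr_deriv ?_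
      simp [hΔ]
    have h0 := hmin.hasDerivAt_eq_zero hder
    have : ∑ k ∈ S, 2 * s k * (-2 * inner ℝ g (x0 - p k)) = -4 * inner ℝ g g := by
      conv_rhs => rw [hg]
      rw [inner_sum, ← hg, Finset.mul_sum]
      refine Finset.sum_congr rfl fun k _ => ?_
      rw [inner_smul_right]; ring
    rw [this] at h0
    have : inner ℝ g g = 0 := by linarith
    exact inner_self_eq_zero.mp this
  have hsum : ∀ f : ι → ℝ, ∑ k, s k * f k = ∑ k ∈ S, s k * f k := by
    intro f
    symm
    apply Finset.sum_subset (Finset.subset_univ S)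
    intro k _ hk
    rw [hsn k hk, zero_mul]
  obtain ⟨k1, hk1, hk1p⟩ := hpos
  have hW : 0 < ∑ k, s k :=
    lt_of_lt_of_le hk1p (Finset.single_le_sum (f := s) (fun k _ => hs0 k) (Finset.mem_univ k1))
  set W := ∑ k, s k with hWd
  have hcen : W⁻¹ • ∑ k, s k • p k = x0 := by
    have : g = W • x0 - ∑ k, s k • p k := by
      have h1 : g = ∑ k, s k • (x0 - p k) := by
        rw [hg]
        apply Finset.sum_subset (Finset.subset_univ S)
        intro k _ hk
        rw [hsn k hk, zero_smul]
      rw [h1]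
      simp only [smul_sub, Finset.sum_sub_distrib, hWd, Finset.sum_smul]
    rw [hg0] at this
    rw [← sub_eq_zero.mp this.symm, smul_smul, inv_mul_cancel₀ hW.ne', one_smul]
  have hp1 := sum_sq_center s p x0 hW
  rw [← hWd, hcen] at hp1
  simp only [sub_self, norm_zero] at hp1
  have hA : 0 < ∑ k, s k * v x0 k := by
    refine Finset.sum_pos' (fun k _ => ?_) ⟨k1, Finset.mem_univ _, ?_⟩
    · by_cases hk : k ∈ S
      · rw [hsS k hk]
        rcases le_total (v x0 k) 0 with h | h
        · simp [h]
        · simp only [h, sup_of_le_left]; positivity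
      · simp [hsn k hk]
    · have : 0 < v x0 k1 := by
        rw [hsS k1 hk1] at hk1p
        by_contra hc
        rw [max_eq_right (not_lt.mp hc)] at hk1p
        exact lt_irrefl _ hk1p
      positivity
  refine ⟨(∑ k, s k * v x0 k) / W, by positivity, fun m q hq y => ?_⟩
  by_contra hcon
  push Not at hcon
  have hq1 := sum_sq_center s q y hW
  rw [← hWd] at hq1
  have hle : ∑ i, ∑ j, s i * s j * ‖p i - p j‖ ^ 2 ≤ ∑ i, ∑ j, s i * s j * ‖q i - q j‖ ^ 2 := by
    refine Finset.sum_le_sum fun i _ => Finset.sum_le_sum fun j _ => ?_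
    by_cases hi : i ∈ S
    · by_cases hj : j ∈ S
      · exact mul_le_mul_of_nonneg_left (hq i hi j hj) (mul_nonneg (hs0 i) (hs0 j))
      · simp [hsn j hj]
    · simp [hsn i hi]
  have h1 : ∑ k, s k * ‖x0 - p k‖ ^ 2 ≤ ∑ k, s k * ‖y - q k‖ ^ 2 := by
    rw [hp1, hq1]
    have := mul_le_mul_of_nonneg_left hle (show 0 ≤ (2 * W)⁻¹ by positivity)
    have h2 : 0 ≤ W * ‖y - W⁻¹ • ∑ i, s i • q i‖ ^ 2 := by positivity
    simp only [ne_eq, OfNat.ofNat_ne_zero, not_false_eq_true, zero_pow, mul_zero, zero_add]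
    linarith
  have h2 : ∑ k, s k * v x0 k ≤ ∑ k, s k * (‖y - q k‖ ^ 2 - c k) := by
    simp only [hv, mul_sub, Finset.sum_sub_distrib]
    linarith
  have h3 : ∑ k, s k * (‖y - q k‖ ^ 2 - c k) < ∑ k, s k * ((∑ k, s k * v x0 k) / W) := by
    refine Finset.sum_lt_sum (fun k _ => ?_) ⟨k1, Finset.mem_univ _, ?_⟩
    · by_cases hk : k ∈ S
      · exact mul_le_mul_of_nonneg_left (hcon k hk).le (hs0 k)
      · simp [hsn k hk]
    · exact mul_lt_mul_of_pos_left (hcon k1 hk1) hk1p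
  rw [← Finset.sum_mul, ← hWd, mul_div_cancel₀ _ hW.ne'] at h3
  linarith

lemma exists_isometry {V : Type*} [NormedAddCommGroup V] [InnerProductSpace ℝ V]
    [FiniteDimensional ℝ V] {n : ℕ} (h : Module.finrank ℝ V ≤ n) :
    Nonempty (V →ₗᵢ[ℝ] EuclideanSpace ℝ (Fin n)) := by
  set b := stdOrthonormalBasis ℝ V
  set e : Fin (Module.finrank ℝ V) → EuclideanSpace ℝ (Fin n) :=
    fun i => EuclideanSpace.basisFun (Fin n) ℝ (Fin.castLE h i) with he
  have hon : Orthonormal ℝ e :=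
    (EuclideanSpace.basisFun (Fin n) ℝ).orthonormal.comp _ (Fin.castLE_injective h)
  refine ⟨LinearMap.isometryOfOrthonormal (b.toBasis.constr ℝ e) (v := b.toBasis) (by simpa using b.orthonormal) ?_⟩
  convert hon using 1
  ext1 i
  simp only [Function.comp]
  rw [Module.Basis.constr_basis]

lemma realize_aux {V : Type*} [NormedAddCommGroup V] [InnerProductSpace ℝ V]
    {n : ℕ} (S : Finset ι) (hS : S.card ≤ n + 1) (X : ι → V) :
    ∃ P : ι → EuclideanSpace ℝ (Fin n), ∀ i ∈ S, ∀ j ∈ S, ‖P i - P j‖ = ‖X i - X j‖ := by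
  classical
  rcases S.eq_empty_or_nonempty with rfl | ⟨i0, hi0⟩
  · exact ⟨fun _ => 0, by simp⟩
  have hfd : FiniteDimensional ℝ (vectorSpan ℝ (↑(S.image X) : Set V)) :=
    finiteDimensional_vectorSpan_of_finite ℝ (Finset.finite_toSet _)
  have hfr : Module.finrank ℝ (vectorSpan ℝ (↑(S.image X) : Set V)) ≤ n := by
    obtain ⟨m, hm⟩ : ∃ m, S.card = m + 1 :=
      Nat.exists_eq_succ_of_ne_zero (Finset.card_ne_zero_of_mem hi0)
    exact (finrank_vectorSpan_image_finset_le ℝ X S hm).trans (by omega)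
  obtain ⟨f⟩ := exists_isometry hfr
  have hmem : ∀ i ∈ S, X i - X i0 ∈ vectorSpan ℝ (↑(S.image X) : Set V) := by
    intro i hi
    rw [← vsub_eq_sub]
    exact vsub_mem_vectorSpan ℝ (by simpa using ⟨i, hi, rfl⟩) (by simpa using ⟨i0, hi0, rfl⟩)
  refine ⟨fun i => if h : i ∈ S then f ⟨X i - X i0, hmem i h⟩ else 0, fun i hi j hj => ?_⟩
  simp only [hi, hj, dif_pos]
  rw [← map_sub, f.norm_map]
  rw [Submodule.coe_norm]
  simp only [Submodule.coe_sub, sub_sub_sub_cancel_right]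

lemma realize {d : ℕ} (S : Finset ι) (hS : S.card ≤ d + 3) (p q : ι → EuclideanSpace ℝ (Fin d))
    {t : ℝ} (h0 : 0 ≤ t) (h1 : t ≤ 1) :
    ∃ P : ι → EuclideanSpace ℝ (Fin (d + 2)), ∀ i ∈ S, ∀ j ∈ S,
      ‖p i - p j‖ ^ 2 + t * (‖q i - q j‖ ^ 2 - ‖p i - p j‖ ^ 2) = ‖P i - P j‖ ^ 2 := by
  obtain ⟨P, hP⟩ := realize_aux (n := d + 2) S hS (fun i => (WithLp.toLp 2
    (Real.sqrt (1 - t) • p i, Real.sqrt t • q i) :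
      WithLp 2 (EuclideanSpace ℝ (Fin d) × EuclideanSpace ℝ (Fin d))))
  refine ⟨P, fun i hi j hj => ?_⟩
  rw [hP i hi j hj, WithLp.prod_norm_sq_eq_of_L2]
  change _ = ‖Real.sqrt (1 - t) • p i - Real.sqrt (1 - t) • p j‖ ^ 2 +
    ‖Real.sqrt t • q i - Real.sqrt t • q j‖ ^ 2
  rw [← smul_sub, ← smul_sub, norm_smul, norm_smul, mul_pow, mul_pow, Real.norm_eq_abs,
    Real.norm_eq_abs, sq_abs, sq_abs]
  rw [Real.sq_sqrt h0, Real.sq_sqrt (by linarith)]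
  ring

end KP

namespace KP
open Finset
variable {ι : Type*} [Fintype ι] [DecidableEq ι]

noncomputable def Gp (b : ℕ) : Polynomial ℝ := 1 - (1 - Polynomial.X) ^ b
noncomputable def QS (b : ι → ℕ) (S : Finset ι) : ι → Polynomial ℝ :=
  fun k => if k ∈ S then Gp (b k) else 1

lemma Gp_eval (b : ℕ) (y : ℝ) : (Gp b).eval y = 1 - (1 - y) ^ b := by simp [Gp]

lemma Gpd_eval (b : ℕ) (y : ℝ) :
    (Polynomial.X * Polynomial.derivative (Gp b)).eval y = b * y * (1 - y) ^ (b - 1) := by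
  simp [Gp, Polynomial.derivative_pow]; ring

lemma Gp_coeff {b : ℕ} : (Gp b).coeff 0 = 0 := by
  rw [Polynomial.coeff_zero_eq_eval_zero, Gp_eval]; simp

lemma Gp_natDegree (b : ℕ) : (Gp b).natDegree ≤ b := by
  unfold Gp
  refine (Polynomial.natDegree_sub_le _ _).trans (max_le (by simp) ?_)
  refine Polynomial.natDegree_pow_le.trans ?_
  have : (1 - Polynomial.X : Polynomial ℝ).natDegree ≤ 1 :=
    (Polynomial.natDegree_sub_le _ _).trans (by simp)
  nlinarith

lemma Xd_natDegree {q : Polynomial ℝ} {M : ℕ} (h : q.natDegree < M) :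
    (Polynomial.X * Polynomial.derivative q).natDegree < M := by
  by_cases h0 : q.natDegree = 0
  · rw [Polynomial.natDegree_eq_zero] at h0
    obtain ⟨c, rfl⟩ := h0
    simp at h ⊢; exact h
  · refine lt_of_le_of_lt (Polynomial.natDegree_mul_le.trans ?_) h
    have := Polynomial.natDegree_derivative_lt h0
    have := Polynomial.natDegree_X_le (R := ℝ)
    omega

lemma QS_natDegree (b : ι → ℕ) (S : Finset ι) (k : ι) : (QS b S k).natDegree < (∑ i, b i) + 1 := by
  unfold QS
  split_ifs
  · have := Gp_natDegree (b k)
    have := Finset.single_le_sum (f := b) (fun i _ => Nat.zero_le _) (Finset.mem_univ k)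
    omega
  · simp

lemma Qd_natDegree (b : ι → ℕ) (S : Finset ι) (i j k : ι) :
    (Qd (QS b S) i j k).natDegree < (∑ i, b i) + 1 := by
  unfold Qd
  split_ifs
  · exact Xd_natDegree (QS_natDegree b S k)
  · exact QS_natDegree b S k

lemma G_nonneg {b : ℕ} {y : ℝ} (h0 : 0 ≤ y) (h1 : y ≤ 1) : 0 ≤ 1 - (1 - y) ^ b := by
  have : (1 - y) ^ b ≤ 1 := pow_le_one₀ (by linarith) (by linarith)
  linarith
lemma G_le_one {b : ℕ} {y : ℝ} (h1 : y ≤ 1) : 1 - (1 - y) ^ b ≤ 1 := by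
  have : 0 ≤ (1 - y) ^ b := pow_nonneg (by linarith) _
  linarith
lemma G_le_mul {b : ℕ} {y : ℝ} (h1 : y ≤ 1) : 1 - (1 - y) ^ b ≤ b * y := by
  have := one_add_mul_le_pow (a := -y) (by linarith) b
  have e : 1 + -y = 1 - y := by ring
  rw [e] at this
  linarith
lemma G1_nonneg {b : ℕ} {y : ℝ} (h0 : 0 ≤ y) (h1 : y ≤ 1) : 0 ≤ b * y * (1 - y) ^ (b - 1) := by
  have : 0 ≤ (1 - y) ^ (b - 1) := pow_nonneg (by linarith) _
  positivity
lemma G1_le {b : ℕ} {y : ℝ} (h0 : 0 ≤ y) (h1 : y ≤ 1) :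
    b * y * (1 - y) ^ (b - 1) ≤ 1 - (1 - y) ^ b := by
  cases b with
  | zero => simp
  | succ m =>
    simp only [Nat.add_sub_cancel]
    have h2 := one_add_mul_le_pow (a := y) (by linarith) m
    have h3 : 0 ≤ (1 - y) ^ m := pow_nonneg (by linarith) _
    have h4 : (1 - y) ^ m * (1 + y) ^ m ≤ 1 := by
      rw [← mul_pow]
      exact pow_le_one₀ (by nlinarith) (by nlinarith)
    have h5 := mul_le_mul_of_nonneg_left h2 h3
    rw [pow_succ]
    push_cast
    nlinarith

/-- multiplicities -/
noncomputable def bb (c : ι → ℝ) (a : ℝ) : ι → ℕ := fun i => ⌈Real.exp (a * c i)⌉₊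

lemma bb_le {c : ι → ℝ} {a : ℝ} (ha : 0 ≤ a) (hc : ∀ i, 0 ≤ c i) (i : ι) :
    (bb c a i : ℝ) ≤ 2 * Real.exp (a * c i) := by
  have h1 : 1 ≤ Real.exp (a * c i) := Real.one_le_exp (mul_nonneg ha (hc i))
  have := Nat.ceil_lt_add_one (Real.exp_pos (a * c i)).le
  unfold bb
  linarith

lemma le_bb {c : ι → ℝ} {a : ℝ} (i : ι) : Real.exp (a * c i) ≤ bb c a i := Nat.le_ceil _

lemma y_le_one {a u : ℝ} (ha : 0 ≤ a) (hu : 0 ≤ u) : Real.exp (-(a * u)) ≤ 1 := by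
  rw [Real.exp_le_one_iff]; nlinarith [mul_nonneg ha hu]

lemma G_le_exp {c : ι → ℝ} {a u : ℝ} (ha : 0 ≤ a) (hc : ∀ i, 0 ≤ c i) (hu : 0 ≤ u) (i : ι) :
    1 - (1 - Real.exp (-(a * u))) ^ (bb c a i) ≤ 2 * Real.exp (-(a * (u - c i))) := by
  refine (G_le_mul (y_le_one ha hu)).trans ?_
  have := mul_le_mul_of_nonneg_right (bb_le ha hc i) (Real.exp_pos (-(a * u))).le
  refine this.trans (le_of_eq ?_)
  rw [mul_assoc, ← Real.exp_add]
  congr 2; ring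

lemma G_le_exp' {c : ι → ℝ} {a u : ℝ} (ha : 1 ≤ a) (hc : ∀ i, 0 ≤ c i) (hu : 0 ≤ u) (i : ι) :
    1 - (1 - Real.exp (-(a * u))) ^ (bb c a i) ≤ 2 * Real.exp (-(u - c i)) := by
  rcases le_total (c i) u with h | h
  · refine (G_le_exp (by linarith) hc hu i).trans ?_
    have : Real.exp (-(a * (u - c i))) ≤ Real.exp (-(u - c i)) := by
      apply Real.exp_le_exp.mpr; nlinarith
    linarith
  · have h1 : 1 ≤ Real.exp (-(u - c i)) := Real.one_le_exp (by linarith)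
    have := G_le_one (b := bb c a i) (y_le_one (show 0 ≤ a by linarith) hu)
    linarith

lemma G_tendsto_one {c : ι → ℝ} {u : ℝ} (hu : 0 ≤ u) (i : ι) (h : u < c i) :
    Filter.Tendsto (fun n : ℕ => 1 - (1 - Real.exp (-((n : ℝ) * u))) ^ (bb c n i)) Filter.atTop (nhds 1) := by
  have h1 : Filter.Tendsto (fun n : ℕ => Real.exp (-Real.exp ((n : ℝ) * (c i - u)))) Filter.atTop (nhds 0) := by
    apply Real.tendsto_exp_neg_atTop_nhds_zero.comp
    apply Real.tendsto_exp_atTop.comp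
    exact tendsto_natCast_atTop_atTop.atTop_mul_const (by linarith)
  have h2 : Filter.Tendsto (fun n : ℕ => (1 - Real.exp (-((n : ℝ) * u))) ^ (bb c n i)) Filter.atTop (nhds 0) := by
    refine squeeze_zero (fun n => ?_) (fun n => ?_) h1
    · have := y_le_one (Nat.cast_nonneg n : (0:ℝ) ≤ n) hu
      exact pow_nonneg (by linarith) _
    · have hy := y_le_one (Nat.cast_nonneg n : (0:ℝ) ≤ n) hu
      have h3 : 1 - Real.exp (-((n : ℝ) * u)) ≤ Real.exp (-Real.exp (-((n : ℝ) * u))) := by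
        have := Real.add_one_le_exp (-Real.exp (-((n : ℝ) * u)))
        linarith
      refine (pow_le_pow_left₀ (by linarith) h3 _).trans ?_
      rw [← Real.exp_nat_mul]
      apply Real.exp_le_exp.mpr
      have := mul_le_mul_of_nonneg_right (le_bb (c := c) (a := n) i) (Real.exp_pos (-((n : ℝ) * u))).le
      rw [← Real.exp_add] at this
      have e : (n : ℝ) * c i + -(n * u) = n * (c i - u) := by ring
      rw [e] at this
      linarith
  simpa using h2.const_sub 1

lemma G_tendsto_zero {c : ι → ℝ} (hc : ∀ i, 0 ≤ c i) {u : ℝ} (hu : 0 ≤ u) (i : ι) (h : c i < u) :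
    Filter.Tendsto (fun n : ℕ => 1 - (1 - Real.exp (-((n : ℝ) * u))) ^ (bb c n i)) Filter.atTop (nhds 0) := by
  have h1 : Filter.Tendsto (fun n : ℕ => 2 * Real.exp (-((n : ℝ) * (u - c i)))) Filter.atTop (nhds (2 * 0)) := by
    apply Filter.Tendsto.const_mul
    apply Real.tendsto_exp_neg_atTop_nhds_zero.comp
    exact tendsto_natCast_atTop_atTop.atTop_mul_const (by linarith)
  rw [mul_zero] at h1
  exact squeeze_zero (fun n => G_nonneg (Real.exp_pos _).le (y_le_one (Nat.cast_nonneg n) hu))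
    (fun n => G_le_exp (Nat.cast_nonneg n) hc hu i) h1

lemma Qd_eval (b : ι → ℕ) (S : Finset ι) (i j k : ι) (y : ℝ) :
    (Qd (QS b S) i j k).eval y = if k ∈ S then
      (if k = i ∨ k = j then b k * y * (1 - y) ^ (b k - 1) else 1 - (1 - y) ^ (b k))
      else (if k = i ∨ k = j then 0 else 1) := by
  unfold Qd QS
  by_cases h1 : k ∈ S <;> by_cases h2 : k = i ∨ k = j
  · simp only [h1, h2, if_true]; rw [Gpd_eval]
  · simp only [h1, h2, if_true, if_false]; rw [Gp_eval]
  · simp [h1, h2]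
  · simp [h1, h2]

lemma altsum_nonneg (b : ι → ℕ) (N : Finset ι) {i j : ι} (hij : i ≠ j) (hi : i ∈ N) (hj : j ∈ N)
    (y : ι → ℝ) (hy0 : ∀ k, 0 ≤ y k) (hy1 : ∀ k, y k ≤ 1) :
    0 ≤ ∑ S ∈ N.powerset, (-1 : ℝ) ^ S.card * ∏ k, (Qd (QS b S) i j k).eval (y k) := by
  set A : ι → ℝ := fun k => if k = i ∨ k = j then b k * y k * (1 - y k) ^ (b k - 1) else 1 - (1 - y k) ^ (b k) with hA
  set B : ι → ℝ := fun k => if k = i ∨ k = j then 0 else 1 with hB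
  have e : ∑ S ∈ N.powerset, (-1 : ℝ) ^ S.card * ∏ k, (Qd (QS b S) i j k).eval (y k) =
      ∏ k ∈ N, (-A k + B k) := by
    rw [Finset.prod_add]
    refine Finset.sum_congr rfl fun S hS => ?_
    rw [Finset.mem_powerset] at hS
    have h1 : ∏ k, (Qd (QS b S) i j k).eval (y k) = ∏ k ∈ N, (if k ∈ S then A k else B k) := by
      symm
      simp only [Qd_eval]
      apply Finset.prod_subset (Finset.subset_univ N)
      intro k _ hk
      have hkS : k ∉ S := fun h => hk (hS h)
      have : ¬ (k = i ∨ k = j) := by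
        rintro (rfl | rfl) <;> contradiction
      simp [hkS, hB, this]
    have h2 : ∏ k ∈ N, (if k ∈ S then A k else B k) = (∏ k ∈ S, A k) * ∏ k ∈ N \ S, B k := by
      rw [← Finset.prod_sdiff hS, mul_comm]
      congr 1
      · exact Finset.prod_congr rfl fun k hk => by simp [hk]
      · exact Finset.prod_congr rfl fun k hk => by simp [(Finset.mem_sdiff.mp hk).2]
    rw [h1, h2, ← mul_assoc, Finset.prod_neg]
  rw [e]
  have e2 : ∀ k, -A k + B k = (if k = i then -1 else 1) * (if k = j then -1 else 1) *
      (if k = i ∨ k = j then b k * y k * (1 - y k) ^ (b k - 1) else (1 - y k) ^ (b k)) := by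
    intro k
    simp only [hA, hB]
    by_cases h1 : k = i
    · subst h1; simp [hij]
    · by_cases h2 : k = j
      · subst h2; simp [h1]
      · simp [h1, h2]
  simp only [e2]
  rw [Finset.prod_mul_distrib, Finset.prod_mul_distrib]
  have h3 : (∏ k ∈ N, (if k = i then (-1 : ℝ) else 1)) = -1 := by simp [hi]
  have h4 : (∏ k ∈ N, (if k = j then (-1 : ℝ) else 1)) = -1 := by simp [hj]
  rw [h3, h4]
  have : 0 ≤ ∏ k ∈ N, (if k = i ∨ k = j then b k * y k * (1 - y k) ^ (b k - 1) else (1 - y k) ^ (b k)) := by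
    refine Finset.prod_nonneg fun k _ => ?_
    split_ifs
    · exact G1_nonneg (hy0 k) (hy1 k)
    · exact pow_nonneg (by linarith [hy1 k]) _
  linarith

lemma Qd_eval_bounds (b : ι → ℕ) (S : Finset ι) (i j k : ι) {y : ℝ} (h0 : 0 ≤ y) (h1 : y ≤ 1) :
    0 ≤ (Qd (QS b S) i j k).eval y ∧ (Qd (QS b S) i j k).eval y ≤ 1 ∧
      (k ∈ S → (Qd (QS b S) i j k).eval y ≤ 1 - (1 - y) ^ (b k)) := by
  rw [Qd_eval]
  have := G_nonneg (b := b k) h0 h1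
  have := G_le_one (b := b k) h1
  have := G1_nonneg (b := b k) h0 h1
  have := G1_le (b := b k) h0 h1
  split_ifs with h h' <;> refine ⟨?_, ?_, fun hk => ?_⟩ <;> first | linarith | contradiction

end KP

namespace KP
open Finset
variable {ι : Type*} [Fintype ι] [DecidableEq ι]

lemma gauss1 {n : ℕ} {b : ℝ} (hb : 0 < b) (P : EuclideanSpace ℝ (Fin n)) :
    Integrable (fun x : EuclideanSpace ℝ (Fin n) => Real.exp (-(b * ‖x - P‖ ^ 2))) ∧
    ∫ x : EuclideanSpace ℝ (Fin n), Real.exp (-(b * ‖x - P‖ ^ 2)) =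
      (Real.pi / b) ^ ((n : ℝ) / 2) := by
  have := gauss (ι := Unit) (fun _ => b) (fun _ => P) (by simpa using hb)
  simpa using this

lemma H_tendsto {d : ℕ} [Nontrivial (EuclideanSpace ℝ (Fin d))]
    (p : ι → EuclideanSpace ℝ (Fin d)) (r : ι → ℝ) (hr : ∀ i, 0 ≤ r i)
    (S : Finset ι) (hS : S.Nonempty) :
    Filter.Tendsto (fun n : ℕ => H d (n : ℝ) ((∑ i, bb (fun i => r i ^ 2) n i) + 1)
        (QS (bb (fun i => r i ^ 2) n) S) (fun i j => ‖p i - p j‖ ^ 2)) Filter.atTop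
      (nhds (volume.real (⋂ i ∈ S, closedBall (p i) (r i)))) := by
  classical
  obtain ⟨i0, hi0⟩ := hS
  set c : ι → ℝ := fun i => r i ^ 2 with hcd
  have hc : ∀ i, 0 ≤ c i := fun i => sq_nonneg _
  have hH : ∀ n : ℕ, 1 ≤ n → _ := fun n hn =>
    H_integral (n := d) (a := (n : ℝ)) (by exact_mod_cast hn)
      (fun i => QS_natDegree (bb c n) S i) (i0 := i0)
      (by simp [QS, hi0, Gp_coeff]) S (fun i hi => by simp [QS, hi]) p
      (fun i j => ‖p i - p j‖ ^ 2) (fun i _ j _ => rfl)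
  have hmeas : MeasurableSet (⋂ i ∈ S, closedBall (p i) (r i)) :=
    Finset.measurableSet_biInter _ fun i _ => measurableSet_closedBall
  have hvol : volume.real (⋂ i ∈ S, closedBall (p i) (r i)) =
      ∫ x, (⋂ i ∈ S, closedBall (p i) (r i)).indicator (fun _ => (1 : ℝ)) x := by
    rw [integral_indicator hmeas]; simp
  rw [hvol]
  have heval : ∀ (n : ℕ) (k : ι) (y : ℝ), (QS (bb c n) S k).eval y =
      if k ∈ S then 1 - (1 - y) ^ (bb c n k) else 1 := by
    intro n k y
    unfold QS
    split_ifs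
    · rw [Gp_eval]
    · simp
  have hlim : Filter.Tendsto (fun n : ℕ => ∫ x : EuclideanSpace ℝ (Fin d),
      ∏ i, (QS (bb c n) S i).eval (Real.exp (-((n : ℝ) * ‖x - p i‖ ^ 2)))) Filter.atTop
      (nhds (∫ x, (⋂ i ∈ S, closedBall (p i) (r i)).indicator (fun _ => (1 : ℝ)) x)) := by
    refine tendsto_integral_filter_of_dominated_convergence
      (fun x => 2 * Real.exp (c i0) * Real.exp (-(1 * ‖x - p i0‖ ^ 2))) ?_ ?_ ?_ ?_
    · filter_upwards [Filter.eventually_ge_atTop 1] with n hn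
      exact (hH n hn).1.aestronglyMeasurable
    · filter_upwards [Filter.eventually_ge_atTop 1] with n hn
      refine Filter.Eventually.of_forall fun x => ?_
      have hn' : (1 : ℝ) ≤ n := by exact_mod_cast hn
      have hb : ∀ k, 0 ≤ (QS (bb c n) S k).eval (Real.exp (-((n : ℝ) * ‖x - p k‖ ^ 2))) ∧
          (QS (bb c n) S k).eval (Real.exp (-((n : ℝ) * ‖x - p k‖ ^ 2))) ≤ 1 := by
        intro k
        have hy := y_le_one (show (0:ℝ) ≤ n by linarith) (sq_nonneg ‖x - p k‖)
        rw [heval]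
        split_ifs
        · exact ⟨G_nonneg (Real.exp_pos _).le hy, G_le_one hy⟩
        · simp
      rw [Real.norm_eq_abs, abs_of_nonneg (Finset.prod_nonneg fun k _ => (hb k).1)]
      have h1 : ∏ i, (QS (bb c n) S i).eval (Real.exp (-((n : ℝ) * ‖x - p i‖ ^ 2))) ≤
          (QS (bb c n) S i0).eval (Real.exp (-((n : ℝ) * ‖x - p i0‖ ^ 2))) := by
        rw [← Finset.mul_prod_erase _ _ (Finset.mem_univ i0)]
        exact mul_le_of_le_one_right (hb i0).1
          (Finset.prod_le_one (fun k _ => (hb k).1) (fun k _ => (hb k).2))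
      refine h1.trans ?_
      rw [heval, if_pos hi0]
      refine (G_le_exp' hn' hc (sq_nonneg _) i0).trans (le_of_eq ?_)
      rw [mul_assoc, ← Real.exp_add]
      congr 2; ring
    · exact (gauss1 one_pos (p i0)).1.const_mul _
    · have hsph : ∀ᵐ x : EuclideanSpace ℝ (Fin d), ∀ k, x ∉ sphere (p k) (r k) := by
        rw [ae_all_iff]
        intro k
        exact measure_eq_zero_iff_ae_notMem.mp (Measure.addHaar_sphere volume (p k) (r k))
      filter_upwards [hsph] with x hx
      have hind : (⋂ i ∈ S, closedBall (p i) (r i)).indicator (fun _ => (1 : ℝ)) x =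
          ∏ k, if k ∈ S then (if ‖x - p k‖ < r k then (1:ℝ) else 0) else 1 := by
        by_cases hmem : x ∈ ⋂ i ∈ S, closedBall (p i) (r i)
        · rw [Set.indicator_of_mem hmem]
          symm
          refine Finset.prod_eq_one fun k _ => ?_
          split_ifs with h1 h2
          · rfl
          · exfalso
            simp only [Set.mem_iInter] at hmem
            have := hmem k h1
            rw [mem_closedBall, dist_eq_norm] at this
            apply hx k
            rw [mem_sphere, dist_eq_norm]
            exact le_antisymm this (not_lt.mp h2)
          · rfl
        · rw [Set.indicator_of_notMem hmem]
          symm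
          simp only [Set.mem_iInter, not_forall] at hmem
          obtain ⟨k, hk, hkn⟩ := hmem
          apply Finset.prod_eq_zero (Finset.mem_univ k)
          rw [if_pos hk, if_neg]
          intro hlt
          apply hkn
          rw [mem_closedBall, dist_eq_norm]
          exact hlt.le
      rw [hind]
      refine tendsto_finsetProd _ fun k _ => ?_
      simp only [heval]
      by_cases hk : k ∈ S
      · simp only [hk, if_true]
        split_ifs with hlt
        · exact G_tendsto_one (sq_nonneg _) k (by simp only [hcd]; gcongr)
        · refine G_tendsto_zero hc (sq_nonneg _) k ?_
          have hne : ‖x - p k‖ ≠ r k := by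
            intro h
            apply hx k
            rw [mem_sphere, dist_eq_norm, h]
          have : r k < ‖x - p k‖ := lt_of_le_of_ne (not_lt.mp hlt) hne.symm
          simp only [hcd]
          have := hr k
          gcongr
      · simp [hk]
  refine hlim.congr' ?_
  filter_upwards [Filter.eventually_ge_atTop 1] with n hn
  exact (hH n hn).2

lemma vol_tendsto {d : ℕ} [Nontrivial (EuclideanSpace ℝ (Fin d))]
    (p : ι → EuclideanSpace ℝ (Fin d)) (r : ι → ℝ) (hr : ∀ i, 0 ≤ r i)
    (K : Finset (Finset ι)) (hK : ∀ S ∈ K, S.Nonempty)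
    (hK' : ∀ S : Finset ι, S.Nonempty → S ∉ K → (⋂ i ∈ S, closedBall (p i) (r i)) = ∅) :
    Filter.Tendsto (fun n : ℕ => ∑ S ∈ K, (-1 : ℝ) ^ (#S + 1) *
        H d (n : ℝ) ((∑ i, bb (fun i => r i ^ 2) n i) + 1)
        (QS (bb (fun i => r i ^ 2) n) S) (fun i j => ‖p i - p j‖ ^ 2)) Filter.atTop
      (nhds (volume.real (⋃ i, closedBall (p i) (r i)))) := by
  have h1 := measureReal_biUnion_eq_sum_powerset (μ := (volume : Measure (EuclideanSpace ℝ (Fin d))))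
    (t := (Finset.univ : Finset ι)) (s := fun i => closedBall (p i) (r i))
    (fun i _ => measurableSet_closedBall) (fun i _ => measure_closedBall_lt_top.ne)
  have h2 : (⋃ i ∈ (Finset.univ : Finset ι), closedBall (p i) (r i)) = ⋃ i, closedBall (p i) (r i) := by simp
  rw [h2] at h1
  rw [h1]
  have h3 : ∑ u ∈ (Finset.univ : Finset ι).powerset with u.Nonempty,
      (-1 : ℝ) ^ (#u + 1) * volume.real (⋂ i ∈ u, closedBall (p i) (r i)) =
      ∑ u ∈ K, (-1 : ℝ) ^ (#u + 1) * volume.real (⋂ i ∈ u, closedBall (p i) (r i)) := by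
    symm
    apply Finset.sum_subset
    · intro S hS
      simp [hK S hS]
    · intro S hS hSK
      simp only [mem_filter] at hS
      rw [hK' S hS.2 hSK]
      simp
  rw [h3]
  exact tendsto_finsetSum _ fun S hS => (H_tendsto p r hr S (hK S hS)).const_mul _

lemma Hd_integral {n : ℕ} {a : ℝ} (ha : 0 < a) (b : ι → ℕ) {S N : Finset ι} (hSN : S ⊆ N) {i j : ι}
    (hi : i ∈ N) (hj : j ∈ N) (P : ι → EuclideanSpace ℝ (Fin n)) (D : ι → ι → ℝ)
    (hD : ∀ i ∈ N, ∀ j ∈ N, D i j = ‖P i - P j‖ ^ 2) :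
    Integrable (fun x : EuclideanSpace ℝ (Fin n) =>
      ∏ k, (Qd (QS b S) i j k).eval (Real.exp (-(a * ‖x - P k‖ ^ 2)))) ∧
    ∫ x : EuclideanSpace ℝ (Fin n), ∏ k, (Qd (QS b S) i j k).eval (Real.exp (-(a * ‖x - P k‖ ^ 2))) =
      H n a ((∑ i, b i) + 1) (Qd (QS b S) i j) D := by
  refine H_integral ha (Qd_natDegree b S i j) (i0 := i) (by simp [Qd]) N (fun k hk => ?_) P D hD
  have h1 : k ∉ S := fun h => hk (hSN h)
  have h2 : ¬ (k = i ∨ k = j) := by rintro (rfl | rfl) <;> contradiction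
  simp [Qd, QS, h1, h2]

lemma Hd_nonneg {n : ℕ} {a : ℝ} (ha : 0 < a) (b : ι → ℕ) {S N : Finset ι} (hSN : S ⊆ N) {i j : ι}
    (hi : i ∈ N) (hj : j ∈ N) (P : ι → EuclideanSpace ℝ (Fin n)) (D : ι → ι → ℝ)
    (hD : ∀ i ∈ N, ∀ j ∈ N, D i j = ‖P i - P j‖ ^ 2) :
    0 ≤ H n a ((∑ i, b i) + 1) (Qd (QS b S) i j) D := by
  rw [← (Hd_integral ha b hSN hi hj P D hD).2]
  refine integral_nonneg fun x => Finset.prod_nonneg fun k _ => ?_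
  exact (Qd_eval_bounds b S i j k (Real.exp_pos _).le (y_le_one ha.le (sq_nonneg _))).1

lemma Hd_altsum {n : ℕ} {a : ℝ} (ha : 0 < a) (b : ι → ℕ) {N : Finset ι} {i j : ι} (hij : i ≠ j)
    (hi : i ∈ N) (hj : j ∈ N) (P : ι → EuclideanSpace ℝ (Fin n)) (D : ι → ι → ℝ)
    (hD : ∀ i ∈ N, ∀ j ∈ N, D i j = ‖P i - P j‖ ^ 2) :
    0 ≤ ∑ S ∈ N.powerset, (-1 : ℝ) ^ #S * H n a ((∑ i, b i) + 1) (Qd (QS b S) i j) D := by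
  have h : ∀ S ∈ N.powerset, _ := fun S hS =>
    Hd_integral ha b (Finset.mem_powerset.mp hS) hi hj P D hD
  rw [Finset.sum_congr rfl fun S hS => by rw [← (h S hS).2, ← integral_const_mul]]
  rw [← integral_finsetSum _ fun S hS => (h S hS).1.const_mul _]
  refine integral_nonneg fun x => ?_
  exact altsum_nonneg b N hij hi hj _ (fun k => (Real.exp_pos _).le)
    (fun k => y_le_one ha.le (sq_nonneg _))

lemma Hd_err {n : ℕ} {a : ℝ} (ha : 1 ≤ a) (c : ι → ℝ) (hc : ∀ i, 0 ≤ c i) {S : Finset ι} {i j : ι}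
    (hi : i ∈ S) (hj : j ∈ S) (P : ι → EuclideanSpace ℝ (Fin n)) (D : ι → ι → ℝ)
    (hD : ∀ i ∈ S, ∀ j ∈ S, D i j = ‖P i - P j‖ ^ 2) {δ : ℝ}
    (hδ : ∀ y, ∃ k ∈ S, δ ≤ ‖y - P k‖ ^ 2 - c k) :
    H n a ((∑ i, bb c a i) + 1) (Qd (QS (bb c a) S) i j) D ≤
      (2 * Real.exp (c i / 2) * (Real.pi / (1/2)) ^ ((n : ℝ) / 2)) * Real.exp (-(a * δ / 2)) := by
  have ha0 : 0 < a := by linarith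
  obtain ⟨h1, h2⟩ := Hd_integral ha0 (bb c a) (Finset.Subset.refl S) hi hj P D hD
  obtain ⟨g1, g2⟩ := gauss1 (n := n) (b := 1/2) (by norm_num) (P i)
  rw [← h2, ← g2]
  have e : 2 * Real.exp (c i / 2) * (∫ x, Real.exp (-(1/2 * ‖x - P i‖ ^ 2))) * Real.exp (-(a * δ / 2)) =
      ∫ x, (2 * Real.exp (c i / 2) * Real.exp (-(a * δ / 2))) * Real.exp (-(1/2 * ‖x - P i‖ ^ 2)) := by
    rw [integral_const_mul]; ring
  rw [e]
  refine integral_mono h1 (g1.const_mul _) fun x => ?_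
  obtain ⟨k, hk, hkd⟩ := hδ x
  have hb : ∀ k, _ := fun k => Qd_eval_bounds (bb c a) S i j k
    (Real.exp_pos (-(a * ‖x - P k‖ ^ 2))).le (y_le_one ha0.le (sq_nonneg _))
  set F := ∏ k, (Qd (QS (bb c a) S) i j k).eval (Real.exp (-(a * ‖x - P k‖ ^ 2))) with hF
  have hF0 : 0 ≤ F := Finset.prod_nonneg fun k _ => (hb k).1
  have hFk : ∀ k, F ≤ (Qd (QS (bb c a) S) i j k).eval (Real.exp (-(a * ‖x - P k‖ ^ 2))) := by
    intro k
    rw [hF, ← Finset.mul_prod_erase _ _ (Finset.mem_univ k)]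
    exact mul_le_of_le_one_right (hb k).1
      (Finset.prod_le_one (fun k _ => (hb k).1) (fun k _ => (hb k).2.1))
  have hA : F ≤ 2 * Real.exp (-(a * δ)) := by
    refine ((hFk k).trans ((hb k).2.2 hk)).trans ((G_le_exp ha0.le hc (sq_nonneg _) k).trans ?_)
    have : Real.exp (-(a * (‖x - P k‖ ^ 2 - c k))) ≤ Real.exp (-(a * δ)) := by
      apply Real.exp_le_exp.mpr
      have := mul_le_mul_of_nonneg_left hkd ha0.le
      linarith
    linarith
  have hB : F ≤ 2 * Real.exp (-(‖x - P i‖ ^ 2 - c i)) :=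
    ((hFk i).trans ((hb i).2.2 hi)).trans (G_le_exp' ha hc (sq_nonneg _) i)
  change F ≤ _
  refine le_of_sq_le_sq ?_ (by positivity)
  calc F ^ 2 = F * F := by ring
    _ ≤ (2 * Real.exp (-(a * δ))) * (2 * Real.exp (-(‖x - P i‖ ^ 2 - c i))) :=
        mul_le_mul hA hB hF0 (by positivity)
    _ = _ := by
      rw [mul_pow, mul_pow, mul_pow, ← Real.exp_nat_mul, ← Real.exp_nat_mul, ← Real.exp_nat_mul]
      have : (2 * Real.exp (-(a * δ))) * (2 * Real.exp (-(‖x - P i‖ ^ 2 - c i))) =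
        4 * Real.exp (-(a * δ) + -(‖x - P i‖ ^ 2 - c i)) := by rw [Real.exp_add]; ring
      rw [this, mul_assoc, mul_assoc, ← Real.exp_add, ← Real.exp_add]
      congr 1
      · norm_num
      · congr 1; push_cast; ring

end KP

namespace KP
open Finset
variable {ι : Type*} [Fintype ι] [DecidableEq ι]

lemma Hd_zero {n : ℕ} {a : ℝ} {M : ℕ} (b : ι → ℕ) {S : Finset ι} {i j : ι}
    (h : i ∉ S ∨ j ∉ S) (D : ι → ι → ℝ) : H n a M (Qd (QS b S) i j) D = 0 := by
  unfold H
  refine Finset.sum_eq_zero fun k _ => ?_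
  have : ∏ l, (Qd (QS b S) i j l).coeff (k l) = 0 := by
    rcases h with h | h
    · exact Finset.prod_eq_zero (Finset.mem_univ i) (by simp [Qd, QS, h])
    · exact Finset.prod_eq_zero (Finset.mem_univ j) (by simp [Qd, QS, h])
  rw [this, zero_mul]

lemma tendsto_err (C : ℝ) {δ : ℝ} (hδ : 0 < δ) :
    Filter.Tendsto (fun n : ℕ => (n : ℝ) ^ 2 / (2 * Real.pi) * (C * Real.exp (-((n : ℝ) * δ / 2))))
      Filter.atTop (nhds 0) := by
  have h1 := Real.tendsto_pow_mul_exp_neg_atTop_nhds_zero 2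
  have h2 : Filter.Tendsto (fun n : ℕ => (n : ℝ) * (δ / 2)) Filter.atTop Filter.atTop :=
    tendsto_natCast_atTop_atTop.atTop_mul_const (by linarith)
  have h3 := (h1.comp h2).const_mul ((2 / δ) ^ 2 / (2 * Real.pi) * C)
  rw [mul_zero] at h3
  refine h3.congr fun n => ?_
  simp only [Function.comp]
  have : Real.exp (-((n : ℝ) * (δ / 2))) = Real.exp (-((n : ℝ) * δ / 2)) := by congr 1; ring
  rw [this]
  field_simp

lemma pair_bound {d : ℕ} {a : ℝ} (ha : 1 ≤ a) (c : ι → ℝ) (hc : ∀ i, 0 ≤ c i)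
    (K : Finset (Finset ι)) (p : ι → EuclideanSpace ℝ (Fin d)) (δ : Finset ι → ℝ)
    (hδ : ∀ S : Finset ι, S.Nonempty → S ∉ K → ∀ (m : ℕ) (q : ι → EuclideanSpace ℝ (Fin m)),
      (∀ i ∈ S, ∀ j ∈ S, ‖p i - p j‖ ^ 2 ≤ ‖q i - q j‖ ^ 2) → ∀ y, ∃ k ∈ S, δ S ≤ ‖y - q k‖ ^ 2 - c k)
    {i j : ι} (hij : i ≠ j) (N : Finset ι) (hi : i ∈ N) (hj : j ∈ N)
    (hKN : ∀ S ∈ K, i ∈ S → j ∈ S → S ⊆ N) {n : ℕ}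
    (P : ι → EuclideanSpace ℝ (Fin n)) (D : ι → ι → ℝ)
    (hD : ∀ i ∈ N, ∀ j ∈ N, D i j = ‖P i - P j‖ ^ 2)
    (hpD : ∀ i j, ‖p i - p j‖ ^ 2 ≤ D i j) :
    -∑ S : Finset ι, (2 * Real.exp (c i / 2) * (Real.pi / (1/2)) ^ ((n : ℝ) / 2)) * Real.exp (-(a * δ S / 2)) ≤
      ∑ S ∈ K, (-1 : ℝ) ^ #S * H n a ((∑ i, bb c a i) + 1) (Qd (QS (bb c a) S) i j) D := by
  have ha0 : 0 < a := by linarith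
  set h : Finset ι → ℝ := fun S => H n a ((∑ i, bb c a i) + 1) (Qd (QS (bb c a) S) i j) D with hh
  set e : Finset ι → ℝ := fun S =>
    (2 * Real.exp (c i / 2) * (Real.pi / (1/2)) ^ ((n : ℝ) / 2)) * Real.exp (-(a * δ S / 2)) with he
  have he0 : ∀ S, 0 ≤ e S := fun S => by have := Real.pi_pos; simp only [he]; positivity
  have hz : ∀ S, ¬ (i ∈ S ∧ j ∈ S) → h S = 0 := fun S hS =>
    Hd_zero _ (by tauto) D
  have h1 : ∑ S ∈ K, (-1 : ℝ) ^ #S * h S = ∑ S ∈ K ∩ N.powerset, (-1 : ℝ) ^ #S * h S := by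
    symm
    apply Finset.sum_subset Finset.inter_subset_left
    intro S hS hS'
    rw [hz S, mul_zero]
    rintro ⟨h1, h2⟩
    exact hS' (Finset.mem_inter.mpr ⟨hS, Finset.mem_powerset.mpr (hKN S hS h1 h2)⟩)
  have h2 : ∑ S ∈ N.powerset, (-1 : ℝ) ^ #S * h S =
      ∑ S ∈ N.powerset \ K, (-1 : ℝ) ^ #S * h S + ∑ S ∈ K ∩ N.powerset, (-1 : ℝ) ^ #S * h S := by
    rw [Finset.inter_comm, add_comm]
    exact (Finset.sum_inter_add_sum_sdiff _ _ _).symm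
  have h3 : 0 ≤ ∑ S ∈ N.powerset, (-1 : ℝ) ^ #S * h S := Hd_altsum ha0 _ hij hi hj P D hD
  have h4 : ∑ S ∈ N.powerset \ K, (-1 : ℝ) ^ #S * h S ≤ ∑ S, e S := by
    refine (Finset.sum_le_sum (g := e) fun S hS => ?_).trans
      (Finset.sum_le_sum_of_subset_of_nonneg (Finset.subset_univ _) fun S _ _ => he0 S)
    rw [Finset.mem_sdiff, Finset.mem_powerset] at hS
    by_cases hS2 : i ∈ S ∧ j ∈ S
    · have hn : 0 ≤ h S := Hd_nonneg ha0 _ hS.1 hi hj P D hD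
      have hle : h S ≤ e S := by
        refine Hd_err ha c hc hS2.1 hS2.2 P D (fun i hi j hj => hD i (hS.1 hi) j (hS.1 hj)) ?_
        refine hδ S ⟨i, hS2.1⟩ hS.2 n P fun i hi j hj => ?_
        rw [← hD i (hS.1 hi) j (hS.1 hj)]
        exact hpD i j
      rcases neg_one_pow_eq_or ℝ (#S) with h | h <;> rw [h] <;> linarith
    · rw [hz S hS2, mul_zero]; exact he0 S
  rw [h1]
  linarith

lemma main_real {d : ℕ} [Nontrivial (EuclideanSpace ℝ (Fin d))]
    (p q : ι → EuclideanSpace ℝ (Fin d)) (r : ι → ℝ) (hr : ∀ i, 0 ≤ r i)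
    (hN : ∀ i j : ι, i ≠ j → ∃ N : Finset ι, i ∈ N ∧ j ∈ N ∧ #N ≤ d + 3 ∧
      ∀ l, l ∉ N → closedBall (p i) (r i) ∩ closedBall (p j) (r j) ∩ closedBall (p l) (r l) = ∅)
    (hexp : ∀ i j, ‖p i - p j‖ ≤ ‖q i - q j‖) :
    volume.real (⋃ i, closedBall (p i) (r i)) ≤ volume.real (⋃ i, closedBall (q i) (r i)) := by
  classical
  set c : ι → ℝ := fun i => r i ^ 2 with hcd
  have hc : ∀ i, 0 ≤ c i := fun i => sq_nonneg _
  set K : Finset (Finset ι) := Finset.univ.filter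
    (fun S => S.Nonempty ∧ (⋂ i ∈ S, closedBall (p i) (r i)).Nonempty) with hK
  have hKne : ∀ S ∈ K, S.Nonempty := fun S hS => (Finset.mem_filter.mp hS).2.1
  have hKp : ∀ S : Finset ι, S.Nonempty → S ∉ K → (⋂ i ∈ S, closedBall (p i) (r i)) = ∅ := by
    intro S h1 h2
    by_contra h3
    exact h2 (by simp [hK, h1, Set.nonempty_iff_ne_empty, h3])
  have hcb : ∀ {m : ℕ} (x y : EuclideanSpace ℝ (Fin m)) (k : ι), x ∈ closedBall y (r k) ↔ ‖x - y‖ ^ 2 ≤ c k := by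
    intro m x y k
    rw [mem_closedBall, dist_eq_norm]
    exact (sq_le_sq₀ (norm_nonneg _) (hr k)).symm
  have hex : ∀ S : Finset ι, ∃ δ : ℝ, 0 < δ ∧ (S.Nonempty → S ∉ K →
      ∀ (m : ℕ) (q : ι → EuclideanSpace ℝ (Fin m)),
      (∀ i ∈ S, ∀ j ∈ S, ‖p i - p j‖ ^ 2 ≤ ‖q i - q j‖ ^ 2) → ∀ y, ∃ k ∈ S, δ ≤ ‖y - q k‖ ^ 2 - c k) := by
    intro S
    by_cases hS : S.Nonempty ∧ S ∉ K
    · obtain ⟨δ, h1, h2⟩ := kirsz S p c (by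
        intro x
        by_contra hcon
        push Not at hcon
        have : x ∈ ⋂ i ∈ S, closedBall (p i) (r i) := by
          simp only [Set.mem_iInter]
          exact fun k hk => (hcb x (p k) k).mpr (hcon k hk)
        rw [hKp S hS.1 hS.2] at this
        exact this)
      exact ⟨δ, h1, fun _ _ => h2⟩
    · exact ⟨1, one_pos, fun h1 h2 => absurd ⟨h1, h2⟩ hS⟩
  choose δ hδ0 hδ using hex
  have hexp2 : ∀ i j, ‖p i - p j‖ ^ 2 ≤ ‖q i - q j‖ ^ 2 := fun i j =>
    pow_le_pow_left₀ (norm_nonneg _) (hexp i j) 2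
  have hKq : ∀ S : Finset ι, S.Nonempty → S ∉ K → (⋂ i ∈ S, closedBall (q i) (r i)) = ∅ := by
    intro S h1 h2
    rw [Set.eq_empty_iff_forall_notMem]
    intro x hx
    obtain ⟨k, hk, hle⟩ := hδ S h1 h2 d q (fun i _ j _ => hexp2 i j) x
    simp only [Set.mem_iInter] at hx
    have := (hcb x (q k) k).mp (hx k hk)
    linarith [hδ0 S]
  have tp := vol_tendsto p r hr K hKne hKp
  have tq := vol_tendsto q r hr K hKne hKq
  set D0 : ι → ι → ℝ := fun i j => ‖p i - p j‖ ^ 2 with hD0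
  set E : ι → ι → ℝ := fun i j => ‖q i - q j‖ ^ 2 - ‖p i - p j‖ ^ 2 with hE
  have hE0 : ∀ i j, 0 ≤ E i j := fun i j => by simp only [hE]; linarith [hexp2 i j]
  have hEd : ∀ i, E i i = 0 := fun i => by simp [hE]
  set Err : ℕ → ℝ := fun n => ∑ i, ∑ j, E i j * ∑ S : Finset ι, (n : ℝ) ^ 2 / (2 * Real.pi) *
    ((2 * Real.exp (c i / 2) * (Real.pi / (1/2)) ^ (((d + 2 : ℕ) : ℝ) / 2)) *
      Real.exp (-((n : ℝ) * δ S / 2))) with hErr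
  have tE : Filter.Tendsto Err Filter.atTop (nhds 0) := by
    have : Filter.Tendsto Err Filter.atTop (nhds (∑ i : ι, ∑ j : ι, E i j * ∑ S : Finset ι, 0)) := by
      refine tendsto_finsetSum _ fun i _ => tendsto_finsetSum _ fun j _ =>
        Filter.Tendsto.const_mul _ (tendsto_finsetSum _ fun S _ => tendsto_err _ (hδ0 S))
    simpa using this
  have key : ∀ n : ℕ, 1 ≤ n →
      ∑ S ∈ K, (-1 : ℝ) ^ (#S + 1) * H d (n : ℝ) ((∑ i, bb c n i) + 1) (QS (bb c n) S)
        (fun i j => ‖p i - p j‖ ^ 2) ≤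
      ∑ S ∈ K, (-1 : ℝ) ^ (#S + 1) * H d (n : ℝ) ((∑ i, bb c n i) + 1) (QS (bb c n) S)
        (fun i j => ‖q i - q j‖ ^ 2) + Err n := by
    intro n hn
    have hn1 : (1 : ℝ) ≤ n := by exact_mod_cast hn
    have hn0 : (0 : ℝ) < n := by linarith
    set M := (∑ i, bb c n i) + 1 with hM
    set Ψ : ℝ → ℝ := fun t => ∑ S ∈ K, (-1 : ℝ) ^ (#S + 1) * H d (n : ℝ) M (QS (bb c n) S)
        (fun i j => D0 i j + t * E i j) with hΨ
    set Ψ' : ℝ → ℝ := fun t => ∑ i, ∑ j, E i j * ((n : ℝ) ^ 2 / (2 * Real.pi) *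
      ∑ S ∈ K, (-1 : ℝ) ^ #S * H (d + 2) (n : ℝ) M (Qd (QS (bb c n) S) i j)
        (fun i j => D0 i j + t * E i j)) with hΨ'
    have hder : ∀ t, HasDerivAt Ψ (Ψ' t) t := by
      intro t
      have h1 : HasDerivAt Ψ (∑ S ∈ K, (-1 : ℝ) ^ (#S + 1) *
        (-∑ i, ∑ j, E i j * ((n : ℝ) ^ 2 / (2 * Real.pi)) *
        H (d + 2) n M (Qd (QS (bb c n) S) i j) (fun i j => D0 i j + t * E i j))) t := by
        refine HasDerivAt.fun_sum fun S hS => HasDerivAt.const_mul _ ?_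
        obtain ⟨i0, hi0⟩ := hKne S hS
        exact H_deriv hn0 (i0 := i0) (by simp [QS, hi0, Gp_coeff]) D0 E hEd t
      refine h1.congr_deriv ?_
      simp only [hΨ', Finset.mul_sum, ← Finset.sum_neg_distrib]
      rw [Finset.sum_comm]
      refine Finset.sum_congr rfl fun i _ => ?_
      rw [Finset.sum_comm]
      refine Finset.sum_congr rfl fun j _ => Finset.sum_congr rfl fun S _ => ?_
      rw [pow_succ]; ring
    have hbound : ∀ t ∈ Set.Icc (0:ℝ) 1, -Err n ≤ Ψ' t := by
      intro t ht
      simp only [hErr, hΨ', ← Finset.sum_neg_distrib]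
      refine Finset.sum_le_sum fun i _ => Finset.sum_le_sum fun j _ => ?_
      by_cases hij : i = j
      · subst hij; simp [hEd]
      obtain ⟨N, hiN, hjN, hcard, hNe⟩ := hN i j hij
      obtain ⟨P, hP⟩ := realize N hcard p q ht.1 ht.2
      have hKN : ∀ S ∈ K, i ∈ S → j ∈ S → S ⊆ N := by
        intro S hS hi hj l hl
        by_contra hlN
        obtain ⟨x, hx⟩ := (Finset.mem_filter.mp hS).2.2
        simp only [Set.mem_iInter] at hx
        have : x ∈ closedBall (p i) (r i) ∩ closedBall (p j) (r j) ∩ closedBall (p l) (r l) :=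
          ⟨⟨hx i hi, hx j hj⟩, hx l hl⟩
        rw [hNe l hlN] at this
        exact this
      have hb := pair_bound hn1 c hc K p δ hδ hij N hiN hjN hKN P
        (fun i j => D0 i j + t * E i j) hP
        (fun i j => by have := mul_nonneg ht.1 (hE0 i j); simp only [hD0]; linarith)
      rw [← Finset.mul_sum, ← mul_neg, ← mul_neg]
      refine mul_le_mul_of_nonneg_left (mul_le_mul_of_nonneg_left hb ?_) (hE0 i j)
      have := Real.pi_pos
      positivity
    have hmono : MonotoneOn (fun t => Ψ t + Err n * t) (Set.Icc 0 1) := by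
      have hd2 : ∀ t, HasDerivAt (fun t => Ψ t + Err n * t) (Ψ' t + Err n) t := by
        intro t
        have := (hder t).fun_add ((hasDerivAt_id t).const_mul (Err n))
        simpa using this
      refine monotoneOn_of_deriv_nonneg (convex_Icc 0 1)
        (fun t _ => (hd2 t).continuousAt.continuousWithinAt)
        (fun t _ => (hd2 t).differentiableAt.differentiableWithinAt) ?_
      intro t ht
      rw [(hd2 t).deriv]
      linarith [hbound t (interior_subset ht)]
    have h01 := hmono (Set.left_mem_Icc.mpr zero_le_one) (Set.right_mem_Icc.mpr zero_le_one) zero_le_one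
    simp only [hΨ, hD0, hE, zero_mul, add_zero, mul_zero, one_mul, mul_one, add_sub_cancel] at h01
    exact h01
  have tq' := tq.add tE
  rw [add_zero] at tq'
  refine le_of_tendsto_of_tendsto tp tq' ?_
  filter_upwards [Filter.eventually_ge_atTop 1] with n hn
  exact key n hn

end KP

/-- **Kneser–Poulsen conjecture for a small number of intersections.**
If in the initial configuration of closed balls with centers `p` and radii `r` in `E^d`,
each pair of balls has common points with at most `d + 1` of the other balls, then for
every expansion `q` of `p` the volume of the union of the balls does not decrease. -/
theorem kneser_poulsen_few_intersections
    (d N : ℕ) (p q : Fin N → EuclideanSpace ℝ (Fin d)) (r : Fin N → ℝ)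
    (hr : ∀ i, 0 ≤ r i)
    (hfew : ∀ i j : Fin N, i < j →
      Set.ncard {l : Fin N | l ≠ i ∧ l ≠ j ∧
        (closedBall (p i) (r i) ∩ closedBall (p j) (r j) ∩
          closedBall (p l) (r l)).Nonempty} ≤ d + 1)
    (hexp : ∀ i j : Fin N, i < j → dist (p i) (p j) ≤ dist (q i) (q j)) :
    volume (⋃ i, closedBall (p i) (r i)) ≤ volume (⋃ i, closedBall (q i) (r i)) := by
  classical
  rcases Nat.eq_zero_or_pos d with rfl | hd
  · rw [Subsingleton.elim p q]
  have : Nonempty (Fin d) := ⟨⟨0, hd⟩⟩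
  have hfin : ∀ p : Fin N → EuclideanSpace ℝ (Fin d), volume (⋃ i, closedBall (p i) (r i)) ≠ ⊤ := by
    intro p
    refine ((measure_iUnion_le _).trans_lt ?_).ne
    rw [tsum_fintype]
    exact ENNReal.sum_lt_top.mpr fun i _ => measure_closedBall_lt_top
  rw [← ENNReal.toReal_le_toReal (hfin p) (hfin q)]
  have hlt : ∀ i j : Fin N, i < j → ∃ M : Finset (Fin N), i ∈ M ∧ j ∈ M ∧ M.card ≤ d + 3 ∧
      ∀ l, l ∉ M → closedBall (p i) (r i) ∩ closedBall (p j) (r j) ∩ closedBall (p l) (r l) = ∅ := by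
    intro i j hij
    have h := hfew i j hij
    rw [Set.ncard_eq_toFinset_card'] at h
    refine ⟨insert i (insert j ({l : Fin N | l ≠ i ∧ l ≠ j ∧
        (closedBall (p i) (r i) ∩ closedBall (p j) (r j) ∩
          closedBall (p l) (r l)).Nonempty}.toFinset)), by simp, by simp, ?_, ?_⟩
    · refine (Finset.card_insert_le _ _).trans ?_
      have := Finset.card_insert_le j ({l : Fin N | l ≠ i ∧ l ≠ j ∧
        (closedBall (p i) (r i) ∩ closedBall (p j) (r j) ∩
          closedBall (p l) (r l)).Nonempty}.toFinset)
      omega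
    · intro l hl
      simp only [Finset.mem_insert, Set.mem_toFinset, Set.mem_setOf_eq, not_or, not_and] at hl
      exact Set.not_nonempty_iff_eq_empty.mp (hl.2.2 hl.1 hl.2.1)
  refine KP.main_real p q r hr ?_ ?_
  · intro i j hij
    rcases lt_or_gt_of_ne hij with h | h
    · exact hlt i j h
    · obtain ⟨M, h1, h2, h3, h4⟩ := hlt j i h
      refine ⟨M, h2, h1, h3, fun l hl => ?_⟩
      rw [Set.inter_comm (closedBall (p i) (r i))]
      exact h4 l hl
  · intro i j
    rw [← dist_eq_norm, ← dist_eq_norm]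
    rcases lt_trichotomy i j with h | h | h
    · exact hexp i j h
    · subst h; simp
    · rw [dist_comm (p i), dist_comm (q i)]; exact hexp j i h
end

section
/- Let p = (p_1, …, p_N) be a configuration of points in Euclidean space E^d and r = (r_1, …, r_N) nonnegative radii such that each pair of balls has common interior points with at most d + 1 of the other balls; i.e., for every pair of indices i < j there are at most d + 1 indices l ∉ {i, j} for which the interiors of B_d(p_i, r_i), B_d(p_j, r_j) and B_d(p_l, r_l) have a common point. Then for every expansion q = (q_1, …, q_N) of p in E^d, Vol_d[⋃_{i=1}^N B_d(p_i, r_i)] ≤ Vol_d[⋃_{i=1}^N B_d(q_i, r_i)]. -/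
open Metric MeasureTheory

namespace KP

abbrev E (n : ℕ) := EuclideanSpace ℝ (Fin n)

/-- weighted variance identity -/
lemma variance_id {V κ : Type*} [NormedAddCommGroup V] [InnerProductSpace ℝ V] [Fintype κ]
    (w : κ → ℝ) (W : ℝ) (hW : ∑ k, w k = W) (hW0 : W ≠ 0) (v : κ → V) (x : V) :
    ∑ k, w k * ‖x - v k‖ ^ 2 = W * ‖x - W⁻¹ • ∑ k, w k • v k‖ ^ 2
      + (1 / (2 * W)) * ∑ k, ∑ l, w k * w l * ‖v k - v l‖ ^ 2 := by
  have e1 : ∀ k, w k * ‖x - v k‖ ^ 2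
      = w k * ‖x‖ ^ 2 - 2 * (w k * inner ℝ x (v k)) + w k * ‖v k‖ ^ 2 := by
    intro k; rw [norm_sub_sq_real]; ring
  have e2 : ∀ k l, w k * w l * ‖v k - v l‖ ^ 2
      = (w k * ‖v k‖ ^ 2) * w l - 2 * (w k * (w l * inner ℝ (v k) (v l)))
        + w k * (w l * ‖v l‖ ^ 2) := by
    intro k l; rw [norm_sub_sq_real]; ring
  set S := ∑ k, w k • v k with hS
  have hSx : inner ℝ x S = ∑ k, w k * inner ℝ x (v k) := by
    simp [hS, inner_sum, inner_smul_right]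
  have hSS : ‖S‖ ^ 2 = ∑ k, ∑ l, w k * (w l * inner ℝ (v k) (v l)) := by
    rw [← real_inner_self_eq_norm_sq]
    simp only [hS, sum_inner, inner_sum, inner_smul_left, inner_smul_right]
    simp only [conj_trivial]
    refine Finset.sum_congr rfl fun k _ => ?_
    rw [Finset.mul_sum]
    refine Finset.sum_congr rfl fun l _ => ?_
    rw [real_inner_comm]
  simp only [e1, e2, Finset.sum_add_distrib, Finset.sum_sub_distrib, ← Finset.mul_sum,
    ← Finset.sum_mul]
  rw [norm_sub_sq_real, inner_smul_right, norm_smul, mul_pow, hSx, hSS, hW]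
  simp only [← Finset.mul_sum, Real.norm_eq_abs, sq_abs]
  field_simp
  ring

/-- isometric embedding -/
lemma exists_isometry_s1 {V : Type*} [NormedAddCommGroup V] [InnerProductSpace ℝ V]
    [FiniteDimensional ℝ V] (n : ℕ) (h : Module.finrank ℝ V ≤ n) :
    ∃ f : V →ₗ[ℝ] E n, ∀ x, ‖f x‖ = ‖x‖ := by
  let b := stdOrthonormalBasis ℝ V
  let e := EuclideanSpace.basisFun (Fin n) ℝ
  have ho : Orthonormal ℝ (fun i : Fin (Module.finrank ℝ V) => e (Fin.castLE h i)) :=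
    e.orthonormal.comp _ (Fin.castLE_injective h)
  let f := b.toBasis.constr ℝ (fun i : Fin (Module.finrank ℝ V) => e (Fin.castLE h i))
  have hb : Orthonormal ℝ b.toBasis := by simp [b.orthonormal]
  have hf : Orthonormal ℝ (f ∘ b.toBasis) := by
    convert ho using 2
    ext i : 1
    simp [f]
  exact ⟨f, fun x => (f.isometryOfOrthonormal hb hf).norm_map x⟩

lemma gauss_integral (n : ℕ) {b : ℝ} (hb : 0 < b) (y : E n) :
    ∫ x : E n, Real.exp (-b * ‖x - y‖ ^ 2) = (Real.pi / b) ^ ((n : ℝ) / 2) := by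
  rw [integral_sub_right_eq_self (fun x : E n => Real.exp (-b * ‖x‖ ^ 2)) y,
    GaussianFourier.integral_rexp_neg_mul_sq_norm hb]
  simp

lemma gauss_integrable (n : ℕ) {b : ℝ} (hb : 0 < b) (y : E n) :
    Integrable (fun x : E n => Real.exp (-b * ‖x - y‖ ^ 2)) := by
  apply Integrable.of_integral_ne_zero
  rw [gauss_integral n hb]
  have := Real.pi_pos
  positivity

/-- Gaussian bump -/
noncomputable def z {ι : Type*} {n : ℕ} (c : ι → ℝ) (v : ι → E n) (i : ι) (x : E n) : ℝ :=
  Real.exp (c i - ‖x - v i‖ ^ 2)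

noncomputable def G {ι : Type*} (D : ι → ι → ℝ) (c : ι → ℝ) {k : ℕ} (w : Fin k → ι) : ℝ :=
  Real.exp (∑ a, c (w a) - (1 / (2 * (k : ℝ))) * ∑ a, ∑ b, D (w a) (w b))

lemma z_pos {ι : Type*} {n : ℕ} (c : ι → ℝ) (v : ι → E n) (i : ι) (x : E n) : 0 < z c v i x :=
  Real.exp_pos _

lemma z_cont {ι : Type*} {n : ℕ} (c : ι → ℝ) (v : ι → E n) (i : ι) : Continuous (z c v i) := by
  unfold z; fun_prop

lemma z_le {ι : Type*} {n : ℕ} (c : ι → ℝ) (v : ι → E n) (i : ι) (x : E n) :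
    z c v i x ≤ Real.exp (c i) := by
  unfold z; gcongr; nlinarith [sq_nonneg ‖x - v i‖]

lemma z_integrable {ι : Type*} {n : ℕ} (c : ι → ℝ) (v : ι → E n) (i : ι) :
    Integrable (z c v i) := by
  have := (gauss_integrable n one_pos (v i)).const_mul (Real.exp (c i))
  convert this using 2 with x
  rw [← Real.exp_add]; unfold z; congr 1; ring

lemma prod_z {ι : Type*} {n : ℕ} (c : ι → ℝ) (v : ι → E n) {k : ℕ} (hk : 0 < k)
    (w : Fin k → ι) (x : E n) :
    ∏ a, z c v (w a) x = G (fun i j => ‖v i - v j‖ ^ 2) c w *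
      Real.exp (-(k : ℝ) * ‖x - (k : ℝ)⁻¹ • ∑ a, v (w a)‖ ^ 2) := by
  have h := variance_id (fun _ : Fin k => (1 : ℝ)) k (by simp) (by positivity)
    (fun a => v (w a)) x
  simp only [one_mul, one_smul] at h
  unfold z G
  rw [← Real.exp_sum, ← Real.exp_add, Finset.sum_sub_distrib, h]
  congr 1; ring

lemma integrable_prod_z {ι : Type*} {n : ℕ} (c : ι → ℝ) (v : ι → E n) {k : ℕ} (hk : 0 < k)
    (w : Fin k → ι) : Integrable (fun x => ∏ a, z c v (w a) x) := by
  simp only [prod_z c v hk]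
  exact (gauss_integrable n (by positivity) _).const_mul _

lemma integral_prod_z {ι : Type*} {n : ℕ} (c : ι → ℝ) (v : ι → E n) {k : ℕ} (hk : 0 < k)
    (w : Fin k → ι) : ∫ x, ∏ a, z c v (w a) x =
      G (fun i j => ‖v i - v j‖ ^ 2) c w * (Real.pi / k) ^ ((n : ℝ) / 2) := by
  simp only [prod_z c v hk]
  rw [integral_const_mul, gauss_integral n (by positivity)]

/-- sum over words -/
lemma sum_words {ι : Type*} [Fintype ι] (m : ℕ) (a : Fin (m + 1))
    (F : (Fin (m + 1) → ι) → ℝ) :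
    ∑ w, F w = ∑ i, ∑ u : Fin m → ι, F (a.insertNth i u) := by
  rw [← Fintype.sum_prod_type' (f := fun i (u : Fin m → ι) => F (a.insertNth i u))]
  exact (Equiv.sum_comp (Fin.insertNthEquiv (fun _ => ι) a) F).symm

lemma words_one {ι : Type*} [Fintype ι] (m : ℕ) (g zz : ι → ℝ) :
    ∑ w : Fin (m + 1) → ι, (∑ a, g (w a)) * ∏ a, zz (w a)
      = (m + 1) * ((∑ i, g i * zz i) * (∑ i, zz i) ^ m) := by
  simp only [Finset.sum_mul]
  rw [Finset.sum_comm]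
  have : ∀ a : Fin (m + 1), ∑ w : Fin (m + 1) → ι, g (w a) * ∏ a, zz (w a)
      = (∑ i, g i * zz i) * (∑ i, zz i) ^ m := by
    intro a
    rw [sum_words m a, Fintype.sum_pow, Finset.sum_mul_sum]
    refine Finset.sum_congr rfl fun i _ => Finset.sum_congr rfl fun u _ => ?_
    rw [Fin.prod_univ_succAbove _ a]
    simp [mul_assoc]
  simp [this, Finset.sum_mul]

lemma words_two {ι : Type*} [Fintype ι] (m : ℕ) (e : ι → ι → ℝ) (he : ∀ i, e i i = 0)
    (zz : ι → ℝ) :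
    ∑ w : Fin (m + 2) → ι, (∑ a, ∑ b, e (w a) (w b)) * ∏ a, zz (w a)
      = (m + 2) * (m + 1) * ∑ i, ∑ j, e i j * (zz i * zz j * (∑ i, zz i) ^ m) := by
  have key : ∀ a : Fin (m + 2), ∑ w : Fin (m + 2) → ι, (∑ b, e (w a) (w b)) * ∏ a, zz (w a)
      = (m + 1) * ∑ i, ∑ j, e i j * (zz i * zz j * (∑ i, zz i) ^ m) := by
    intro a
    rw [sum_words (m + 1) a]
    have : ∀ i, ∑ u : Fin (m + 1) → ι,
        (∑ b, e ((a.insertNth i u : Fin (m + 2) → ι) a) ((a.insertNth i u : Fin (m + 2) → ι) b))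
          * ∏ b, zz ((a.insertNth i u : Fin (m + 2) → ι) b)
        = (m + 1) * ∑ j, e i j * (zz i * zz j * (∑ i, zz i) ^ m) := by
      intro i
      have h1 := words_one m (e i) zz
      calc _ = ∑ u : Fin (m + 1) → ι, zz i * ((∑ b, e i (u b)) * ∏ b, zz (u b)) := by
            refine Finset.sum_congr rfl fun u _ => ?_
            rw [Fin.prod_univ_succAbove _ a, Fin.sum_univ_succAbove _ a]
            simp [he]; ring
        _ = _ := by
            rw [← Finset.mul_sum, h1, Finset.sum_mul, Finset.mul_sum, Finset.mul_sum,
              Finset.mul_sum]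
            refine Finset.sum_congr rfl fun j _ => ?_
            ring
    simp only [this, ← Finset.mul_sum]
  simp only [Finset.sum_mul] at key ⊢
  rw [Finset.sum_comm]
  have : ∀ a : Fin (m + 2), _ := key
  rw [Finset.sum_congr rfl (fun a _ => key a)]
  simp; ring

lemma hs_congr {f g : ℕ → ℝ} {a b : ℝ} (h : HasSum f a) (hfg : ∀ m, g m = f m) (hab : b = a) :
    HasSum g b := by
  rw [hab, funext hfg]; exact h

/-- coefficients -/
noncomputable def co (s a m : ℕ) : ℝ := (-1) ^ m * ((m : ℝ) + a) ^ s / m.factorial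

lemma hasSum_exp_neg (Z : ℝ) :
    HasSum (fun m : ℕ => (-1) ^ m / (m.factorial : ℝ) * Z ^ m) (Real.exp (-Z)) := by
  have := NormedSpace.expSeries_div_hasSum_exp (𝔸 := ℝ) (-Z)
  rw [← Real.exp_eq_exp_ℝ] at this
  refine hs_congr this (fun m => ?_) rfl
  rw [neg_pow Z]; ring

lemma co_abs_summable (s : ℕ) : ∀ (a : ℕ) (K : ℝ), 0 ≤ K →
    Summable (fun m : ℕ => |co s a m| * K ^ m) := by
  induction s with
  | zero =>
    intro a K hK
    have := Real.summable_pow_div_factorial K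
    refine this.congr fun m => ?_
    simp [co, abs_div]
    ring
  | succ s ih =>
    intro a K hK
    rw [← summable_nat_add_iff 1]
    have h1 := ((summable_nat_add_iff 1).2 (ih a K hK)).mul_left (a : ℝ)
    have h2 := (ih (a + 1) K hK).mul_left K
    refine (h1.add h2).congr fun m => ?_
    simp only [co, abs_div, abs_mul, abs_pow, abs_neg, abs_one, one_pow, Nat.factorial_succ]
    have e1 : |((m + 1 : ℕ) : ℝ) + a| = m + 1 + a := by
      rw [abs_of_nonneg (by positivity)]; push_cast; ring
    have e2 : |(m : ℝ) + ((a + 1 : ℕ) : ℝ)| = m + 1 + a := by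
      rw [abs_of_nonneg (by positivity)]; push_cast; ring
    have e3 : |(m.factorial : ℝ)| = m.factorial := abs_of_nonneg (by positivity)
    have e4 : |(((m + 1) * m.factorial : ℕ) : ℝ)| = (m + 1) * m.factorial := by
      rw [abs_of_nonneg (by positivity)]; push_cast; ring
    rw [e1, e2, e3, e4]
    have : (m.factorial : ℝ) ≠ 0 := by positivity
    have : ((m : ℝ) + 1) ≠ 0 := by positivity
    field_simp
    ring

lemma exists_poly (s : ℕ) : ∀ a : ℕ, ∃ Q : Polynomial ℝ, ∀ Z : ℝ,
    HasSum (fun m : ℕ => co s a m * Z ^ m) (Q.eval Z * Real.exp (-Z)) := by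
  induction s with
  | zero =>
    intro a
    refine ⟨1, fun Z => ?_⟩
    simpa [co] using hasSum_exp_neg Z
  | succ s ih =>
    intro a
    obtain ⟨Q1, h1⟩ := ih a
    obtain ⟨Q2, h2⟩ := ih (a + 1)
    refine ⟨Polynomial.C (a : ℝ) * Q1 - Polynomial.X * Q2, fun Z => ?_⟩
    have h3 : HasSum (fun m : ℕ => (m : ℝ) * co s a m * Z ^ m)
        (-(Z * (Q2.eval Z * Real.exp (-Z)))) := by
      rw [← hasSum_nat_add_iff' 1]
      simp only [Finset.range_one, Finset.sum_singleton, Nat.cast_zero, zero_mul, sub_zero]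
      refine hs_congr ((h2 Z).mul_left Z).neg (fun m => ?_) rfl
      simp only [co, Nat.factorial_succ]
      push_cast
      have : (m.factorial : ℝ) ≠ 0 := by positivity
      have : ((m : ℝ) + 1) ≠ 0 := by positivity
      field_simp
      ring
    refine hs_congr (((h1 Z).mul_left (a : ℝ)).add h3) (fun m => ?_) ?_
    · simp only [co]; ring
    · simp; ring

lemma poly_bound (P : Polynomial ℝ) : ∃ C : ℝ, 0 < C ∧ ∀ x : ℝ, 0 ≤ x →
    |P.eval x * Real.exp (-x)| ≤ C * Real.exp (-x / 2) := by
  let P2 := P.comp (Polynomial.C 2 * Polynomial.X)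
  have ht := Polynomial.tendsto_div_exp_atTop P2
  have ht' := ht.norm.eventually (gt_mem_nhds (show ‖(0 : ℝ)‖ < 1 by simp))
  obtain ⟨M, hM⟩ := Filter.eventually_atTop.1 ht'
  have hc : ContinuousOn (fun x => ‖P2.eval x / Real.exp x‖) (Set.Icc 0 M) := by
    apply Continuous.continuousOn
    apply Continuous.norm
    exact P2.continuous.div Real.continuous_exp (fun x => (Real.exp_pos x).ne')
  obtain ⟨C, hC⟩ := (isCompact_Icc.image_of_continuousOn hc).bddAbove
  refine ⟨max C 1, by positivity, fun x hx => ?_⟩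
  have hb : ‖P2.eval (x / 2) / Real.exp (x / 2)‖ ≤ max C 1 := by
    by_cases h : x / 2 ≤ M
    · exact (hC ⟨x / 2, ⟨by positivity, h⟩, rfl⟩).trans (le_max_left _ _)
    · exact (hM _ (le_of_not_ge h)).le.trans (le_max_right _ _)
  have e : P2.eval (x / 2) = P.eval x := by
    simp only [P2, Polynomial.eval_comp, Polynomial.eval_mul, Polynomial.eval_C, Polynomial.eval_X]
    congr 1; ring
  rw [e, Real.norm_eq_abs] at hb
  have : P.eval x * Real.exp (-x) = P.eval x / Real.exp (x / 2) * Real.exp (-x / 2) := by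
    rw [div_eq_mul_inv, ← Real.exp_neg, mul_assoc, ← Real.exp_add]; congr 2; ring
  rw [this, abs_mul, abs_of_pos (Real.exp_pos (-x / 2))]
  gcongr

lemma poly_lip (Q : Polynomial ℝ) : ∃ C : ℝ, 0 < C ∧ ∀ Y Z : ℝ, 0 ≤ Y → Y ≤ Z →
    |Q.eval Z * Real.exp (-Z) - Q.eval Y * Real.exp (-Y)|
      ≤ C * min 1 (Z - Y) * Real.exp (-Y / 2) := by
  obtain ⟨C1, hC1, h1⟩ := poly_bound Q
  obtain ⟨C2, hC2, h2⟩ := poly_bound (Q.derivative - Q)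
  refine ⟨max (2 * C1) C2, by positivity, fun Y Z hY hYZ => ?_⟩
  have hmono : ∀ x, Y ≤ x → Real.exp (-x / 2) ≤ Real.exp (-Y / 2) := fun x hx => by
    gcongr
  rcases le_total 1 (Z - Y) with h | h
  · rw [min_eq_left h, mul_one]
    calc _ ≤ |Q.eval Z * Real.exp (-Z)| + |Q.eval Y * Real.exp (-Y)| := abs_sub _ _
      _ ≤ C1 * Real.exp (-Y / 2) + C1 * Real.exp (-Y / 2) := by
          refine add_le_add ((h1 Z (hY.trans hYZ)).trans ?_) (h1 Y hY)
          have := hmono Z hYZ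
          gcongr
      _ = 2 * C1 * Real.exp (-Y / 2) := by ring
      _ ≤ _ := by gcongr; exact le_max_left _ _
  · rw [min_eq_right h]
    have hd : ∀ x ∈ Set.Icc Y Z, HasDerivWithinAt (fun x => Q.eval x * Real.exp (-x))
        ((Q.derivative - Q).eval x * Real.exp (-x)) (Set.Icc Y Z) x := by
      intro x _
      have := (Q.hasDerivAt x).mul ((Real.hasDerivAt_exp (-x)).comp x (hasDerivAt_neg x))
      refine (this.congr_deriv ?_).hasDerivWithinAt
      simp; ring
    have := Convex.norm_image_sub_le_of_norm_hasDerivWithin_le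
      (C := C2 * Real.exp (-Y / 2)) hd (fun x hx => ?_) (convex_Icc Y Z)
      (Set.left_mem_Icc.2 hYZ) (Set.right_mem_Icc.2 hYZ)
    · rw [Real.norm_eq_abs, Real.norm_eq_abs, abs_of_nonneg (sub_nonneg.2 hYZ)] at this
      refine this.trans ?_
      rw [mul_right_comm]
      have := sub_nonneg.2 hYZ
      gcongr
      exact le_max_right _ _
    · rw [Real.norm_eq_abs]
      refine (h2 x (hY.trans hx.1)).trans ?_
      have := hmono x hx.1
      gcongr

/-- swapping sum and integral -/
lemma swap {n : ℕ} (f Zf : E n → ℝ) (hf : Integrable f) (hZ : Continuous Zf) (K : ℝ)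
    (h0 : ∀ x, 0 ≤ Zf x) (hK : ∀ x, Zf x ≤ K) (a : ℕ → ℝ)
    (ha : Summable fun m => |a m| * K ^ m) (Φ : ℝ → ℝ)
    (hΦ : ∀ Z, HasSum (fun m => a m * Z ^ m) (Φ Z)) :
    HasSum (fun m => a m * ∫ x, f x * Zf x ^ m) (∫ x, f x * Φ (Zf x)) := by
  have := hasSum_integral_of_dominated_convergence (μ := (volume : Measure (E n)))
    (F := fun m x => a m * (f x * Zf x ^ m)) (f := fun x => f x * Φ (Zf x))
    (fun m x => |f x| * (|a m| * K ^ m))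
    (fun m => ((hf.aestronglyMeasurable.mul (hZ.pow m).aestronglyMeasurable).const_mul _))
    (fun m => Filter.Eventually.of_forall fun x => ?_)
    (Filter.Eventually.of_forall fun x => ha.mul_left _)
    (by
      simp only [tsum_mul_left]
      exact hf.abs.mul_const _)
    (Filter.Eventually.of_forall fun x => ?_)
  · simpa only [integral_const_mul] using this
  · rw [Real.norm_eq_abs, abs_mul, abs_mul, abs_pow, abs_of_nonneg (h0 x)]
    have := pow_le_pow_left₀ (h0 x) (hK x) m
    calc _ = |f x| * (|a m| * Zf x ^ m) := by ring
      _ ≤ _ := by gcongr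
  · refine hs_congr ((hΦ (Zf x)).mul_left (f x)) (fun m => ?_) rfl
    ring

lemma zz_integrable {ι : Type*} {n : ℕ} (c : ι → ℝ) (v : ι → E n) (i j : ι) :
    Integrable (fun x => z c v i x * z c v j x) := by
  refine Integrable.mono' ((z_integrable c v j).const_mul (Real.exp (c i)))
    ((z_cont c v i).mul (z_cont c v j)).aestronglyMeasurable
    (Filter.Eventually.of_forall fun x => ?_)
  rw [Real.norm_eq_abs, abs_of_pos (mul_pos (z_pos _ _ _ _) (z_pos _ _ _ _))]
  have := z_le c v i x
  have := z_pos c v j x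
  gcongr

lemma zzF_integrable {ι : Type*} {n : ℕ} (c : ι → ℝ) (v : ι → E n) (i j : ι) (S : Finset ι)
    (Q : Polynomial ℝ) :
    Integrable (fun x => z c v i x * z c v j x *
      (Q.eval (∑ l ∈ S, z c v l x) * Real.exp (-(∑ l ∈ S, z c v l x)))) := by
  obtain ⟨C, hC, hb⟩ := poly_bound Q
  have hcont : Continuous fun x => ∑ l ∈ S, z c v l x :=
    continuous_finsetSum _ fun l _ => z_cont c v l
  refine Integrable.mono' ((zz_integrable c v i j).mul_const C)
    (((z_cont c v i).mul (z_cont c v j)).mul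
      ((Q.continuous.comp hcont).mul (Real.continuous_exp.comp hcont.neg))).aestronglyMeasurable
    (Filter.Eventually.of_forall fun x => ?_)
  have h0 := mul_pos (z_pos c v i x) (z_pos c v j x)
  rw [norm_mul, Real.norm_eq_abs, Real.norm_eq_abs, abs_of_pos h0]
  have hS : 0 ≤ ∑ l ∈ S, z c v l x := Finset.sum_nonneg fun l _ => (z_pos _ _ _ _).le
  refine mul_le_mul_of_nonneg_left ((hb _ hS).trans ?_) h0.le
  have : Real.exp (-(∑ l ∈ S, z c v l x) / 2) ≤ 1 := by
    rw [Real.exp_le_one_iff]; linarith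
  nlinarith

lemma pair_words {κ : Type*} [Fintype κ] (m : ℕ) (zz : κ → ℝ) (i j : κ) :
    zz i * zz j * (∑ l, zz l) ^ m =
      ∑ u : Fin m → κ, ∏ a, zz ((Fin.cons i (Fin.cons j u : Fin (m + 1) → κ) : Fin (m + 2) → κ) a) := by
  rw [Fintype.sum_pow, Finset.mul_sum]
  refine Finset.sum_congr rfl fun u _ => ?_
  rw [Fin.prod_univ_succ, Fin.prod_univ_succ]
  simp [mul_assoc]

lemma integral_pair {κ : Type*} [Fintype κ] {n : ℕ} (c : κ → ℝ) (v : κ → E n) (i j : κ) (m : ℕ) :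
    ∫ x, z c v i x * z c v j x * (∑ l, z c v l x) ^ m =
      (∑ u : Fin m → κ, G (fun i j => ‖v i - v j‖ ^ 2) c
        (Fin.cons i (Fin.cons j u : Fin (m + 1) → κ) : Fin (m + 2) → κ))
        * (Real.pi / ((m : ℝ) + 2)) ^ ((n : ℝ) / 2) := by
  have h : ∀ x, z c v i x * z c v j x * (∑ l, z c v l x) ^ m = _ :=
    fun x => pair_words m (fun l => z c v l x) i j
  simp only [h]
  rw [integral_finsetSum _ (fun u _ => integrable_prod_z c v (by omega) _), Finset.sum_mul]
  refine Finset.sum_congr rfl fun u _ => ?_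
  rw [integral_prod_z c v (by omega)]
  have : ((m + 2 : ℕ) : ℝ) = (m : ℝ) + 2 := by push_cast; ring
  rw [← this]

lemma sum_z_cont {κ : Type*} [Fintype κ] {n : ℕ} (c : κ → ℝ) (v : κ → E n) :
    Continuous fun x => ∑ l, z c v l x :=
  continuous_finsetSum _ fun l _ => z_cont c v l

lemma pow_id (k : ℝ) (hk : 0 < k) (n s : ℕ) :
    k ^ s * (Real.pi / k) ^ (((n + 2 * s : ℕ) : ℝ) / 2)
      = Real.pi ^ s * (Real.pi / k) ^ ((n : ℝ) / 2) := by
  have hp := Real.pi_pos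
  have : ((n + 2 * s : ℕ) : ℝ) / 2 = (n : ℝ) / 2 + s := by push_cast; ring
  rw [this, Real.rpow_add (by positivity), Real.rpow_natCast, div_pow]
  field_simp

lemma local_pos {κ : Type*} [Fintype κ] (d s : ℕ) (hκ : Fintype.card κ ≤ d + 3)
    (c : κ → ℝ) (v : κ → E (d + 2 + 2 * s)) (i j : κ) (Q : Polynomial ℝ)
    (hQ : ∀ Z : ℝ, HasSum (fun m : ℕ => co s 2 m * Z ^ m) (Q.eval Z * Real.exp (-Z))) :
    0 ≤ ∫ x, z c v i x * z c v j x *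
      (Q.eval (∑ l, z c v l x) * Real.exp (-(∑ l, z c v l x))) := by
  have : Nonempty κ := ⟨i⟩
  obtain ⟨f, hf⟩ := exists_isometry_s1 (V := vectorSpan ℝ (Set.range v)) (d + 2)
    (by have := finrank_vectorSpan_range_add_one_le ℝ v; omega)
  let v' : κ → E (d + 2) := fun k =>
    f ⟨v k - v i, vsub_mem_vectorSpan ℝ (Set.mem_range_self k) (Set.mem_range_self i)⟩
  have hv' : ∀ k l, ‖v' k - v' l‖ ^ 2 = ‖v k - v l‖ ^ 2 := by
    intro k l
    simp only [v']
    rw [← map_sub, hf]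
    simp
  have hK : ∀ {n : ℕ} (v : κ → E n) x, ∑ l, z c v l x ≤ ∑ l, Real.exp (c l) :=
    fun v x => Finset.sum_le_sum fun l _ => z_le c v l x
  have h0 : ∀ {n : ℕ} (v : κ → E n) x, 0 ≤ ∑ l, z c v l x :=
    fun v x => Finset.sum_nonneg fun l _ => (z_pos c v l x).le
  have hK0 : 0 ≤ ∑ l, Real.exp (c l) := Finset.sum_nonneg fun l _ => (Real.exp_pos _).le
  have s1 := swap _ _ (zz_integrable c v i j) (sum_z_cont c v) _ (h0 v) (hK v) (co s 2)
    (co_abs_summable s 2 _ hK0) _ hQ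
  have s2 := swap _ _ (zz_integrable c v' i j) (sum_z_cont c v') _ (h0 v') (hK v') (co 0 2)
    (co_abs_summable 0 2 _ hK0) (fun Z => Real.exp (-Z))
    (fun Z => by simpa [co] using hasSum_exp_neg Z)
  have s3 := s2.mul_left (Real.pi ^ s)
  have : (fun m => co s 2 m * ∫ x, z c v i x * z c v j x * (∑ l, z c v l x) ^ m)
      = fun m => Real.pi ^ s * (co 0 2 m * ∫ x, z c v' i x * z c v' j x * (∑ l, z c v' l x) ^ m) := by
    funext m
    rw [integral_pair, integral_pair]
    simp only [hv', co]
    have := pow_id ((m : ℝ) + 2) (by positivity) (d + 2) s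
    push_cast at this ⊢
    linear_combination ((-1) ^ m / (m.factorial : ℝ) * ∑ u : Fin m → κ, G (fun i j => ‖v i - v j‖ ^ 2) c
        (Fin.cons i (Fin.cons j u : Fin (m + 1) → κ) : Fin (m + 2) → κ)) * this
  rw [this] at s1
  rw [s1.unique s3]
  have := Real.pi_pos
  refine mul_nonneg (by positivity) (integral_nonneg fun x => ?_)
  have := z_pos c v' i x
  have := z_pos c v' j x
  positivity

/-- weights certificate -/
def Cert {ι : Type*} (D : ι → ι → ℝ) (c : ι → ℝ) (δ : ℝ) (i j l : ι) : Prop :=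
  ∃ w : Fin 3 → ℝ, (∀ a, 0 ≤ w a) ∧ ∑ a, w a = 1 ∧
    δ ≤ (1 / 2) * ∑ a, ∑ b, w a * w b * D (![i, j, l] a) (![i, j, l] b)
      - ∑ a, w a * c (![i, j, l] a)

lemma Cert.mono {ι : Type*} {D D' : ι → ι → ℝ} {c : ι → ℝ} {δ : ℝ} {i j l : ι}
    (h : Cert D c δ i j l) (hD : ∀ i j, D i j ≤ D' i j) : Cert D' c δ i j l := by
  obtain ⟨w, h0, h1, h2⟩ := h
  refine ⟨w, h0, h1, h2.trans ?_⟩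
  have : ∑ a, ∑ b, w a * w b * D (![i, j, l] a) (![i, j, l] b)
      ≤ ∑ a, ∑ b, w a * w b * D' (![i, j, l] a) (![i, j, l] b) := by
    refine Finset.sum_le_sum fun a _ => Finset.sum_le_sum fun b _ => ?_
    exact mul_le_mul_of_nonneg_left (hD _ _) (mul_nonneg (h0 a) (h0 b))
  linarith

lemma min_exp_le (w t : ℝ) (h0 : 0 ≤ w) (h1 : w ≤ 1) :
    min 1 (Real.exp t) ≤ Real.exp (w * t) := by
  rcases le_total 0 t with h | h
  · exact (min_le_left _ _).trans (Real.one_le_exp (mul_nonneg h0 h))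
  · refine (min_le_right _ _).trans (Real.exp_le_exp.2 ?_)
    nlinarith

lemma cert_bound {ι : Type*} {n : ℕ} (c : ι → ℝ) (v : ι → E n) (δ : ℝ) (i j l : ι)
    (h : Cert (fun i j => ‖v i - v j‖ ^ 2) c δ i j l) :
    ∃ y : E n, ∀ x, min 1 (z c v i x) * min 1 (z c v j x) * min 1 (z c v l x)
      ≤ Real.exp (-δ) * Real.exp (-1 * ‖x - y‖ ^ 2) := by
  obtain ⟨w, h0, h1, h2⟩ := h
  refine ⟨(1 : ℝ)⁻¹ • ∑ a, w a • v (![i, j, l] a), fun x => ?_⟩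
  have hv := variance_id w 1 h1 one_ne_zero (fun a => v (![i, j, l] a)) x
  have hw : ∀ a, w a ≤ 1 := fun a => by
    rw [← h1]; exact Finset.single_le_sum (fun b _ => h0 b) (Finset.mem_univ a)
  have hm : ∀ a, 0 ≤ min 1 (z c v (![i, j, l] a) x) := fun a =>
    le_min zero_le_one (z_pos _ _ _ _).le
  have hb : ∀ a, min 1 (z c v (![i, j, l] a) x)
      ≤ Real.exp (w a * (c (![i, j, l] a) - ‖x - v (![i, j, l] a)‖ ^ 2)) := fun a =>
    min_exp_le _ _ (h0 a) (hw a)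
  have hp := Finset.prod_le_prod (s := Finset.univ) (fun a _ => hm a) (fun a _ => hb a)
  rw [← Real.exp_sum] at hp
  have e : ∏ a, min 1 (z c v (![i, j, l] a) x)
      = min 1 (z c v i x) * min 1 (z c v j x) * min 1 (z c v l x) := by
    rw [Fin.prod_univ_three]; rfl
  rw [e] at hp
  refine hp.trans ?_
  rw [← Real.exp_add]
  refine Real.exp_le_exp.2 ?_
  simp only [mul_sub, Finset.sum_sub_distrib]
  rw [hv]
  linarith

lemma mul_exp_half_le (t : ℝ) (ht : 0 ≤ t) : t * Real.exp (-t / 2) ≤ min 1 t := by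
  refine le_min ?_ ?_
  · have h1 := Real.add_one_le_exp (t / 2 - 1)
    have h2 : Real.exp (t / 2 - 1) * Real.exp 1 = Real.exp (t / 2) := by
      rw [← Real.exp_add]; congr 1; ring
    have h3 : (2 : ℝ) ≤ Real.exp 1 := by have := Real.add_one_le_exp 1; linarith
    have h4 : t ≤ Real.exp (t / 2) := by
      rw [← h2]; nlinarith [Real.exp_pos (t / 2 - 1)]
    have h5 : Real.exp (-t / 2) * Real.exp (t / 2) = 1 := by
      rw [← Real.exp_add, ← Real.exp_zero]; congr 1; ring
    nlinarith [Real.exp_pos (-t / 2)]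
  · have : Real.exp (-t / 2) ≤ 1 := by rw [Real.exp_le_one_iff]; linarith
    nlinarith

lemma min_sum_le {ι : Type*} (S : Finset ι) (f : ι → ℝ) (hf : ∀ i, 0 ≤ f i) :
    min 1 (∑ i ∈ S, f i) ≤ ∑ i ∈ S, min 1 (f i) := by
  classical
  induction S using Finset.induction_on with
  | empty => simp
  | insert a S ha ih =>
    rw [Finset.sum_insert ha, Finset.sum_insert ha]
    refine le_trans ?_ (add_le_add_right ih _)
    have h1 := hf a
    have h2 : 0 ≤ ∑ i ∈ S, f i := Finset.sum_nonneg fun i _ => hf i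
    rcases le_total 1 (f a) with h | h <;> rcases le_total 1 (∑ i ∈ S, f i) with h' | h' <;>
      simp only [min_eq_left h, min_eq_right h, min_eq_left h', min_eq_right h']
    · exact (min_le_left _ _).trans (by linarith)
    · exact (min_le_left _ _).trans (by linarith)
    · exact (min_le_left _ _).trans (by linarith)
    · exact min_le_right _ _

/-- main pair bound -/
lemma pair_bound_s1 (N d s : ℕ) : ∃ (C : ℝ) (Q : Polynomial ℝ), 0 < C ∧
    (∀ Z : ℝ, HasSum (fun m : ℕ => co s 2 m * Z ^ m) (Q.eval Z * Real.exp (-Z))) ∧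
    ∀ (c : Fin N → ℝ) (v : Fin N → E (d + 2 + 2 * s)) (δ : ℝ) (i j : Fin N) (S : Finset (Fin N)),
      i ≠ j → i ∈ S → j ∈ S → S.card ≤ d + 3 →
      (∀ l, l ∉ S → Cert (fun i j => ‖v i - v j‖ ^ 2) c δ i j l) →
      -(C * Real.exp (-δ)) ≤ ∫ x, z c v i x * z c v j x *
        (Q.eval (∑ l, z c v l x) * Real.exp (-(∑ l, z c v l x))) := by
  obtain ⟨Q, hQ⟩ := exists_poly s 2
  obtain ⟨C, hC, hlip⟩ := poly_lip Q
  have hpi := Real.pi_pos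
  refine ⟨C * (N + 1) * Real.pi ^ (((d + 2 + 2 * s : ℕ) : ℝ) / 2), Q, by positivity, hQ, ?_⟩
  intro c v δ i j S hij hi hj hS hcert
  have hpos : 0 ≤ ∫ x, z c v i x * z c v j x *
      (Q.eval (∑ l ∈ S, z c v l x) * Real.exp (-(∑ l ∈ S, z c v l x))) := by
    have := local_pos (κ := S) d s (by simpa using hS) (fun k => c k) (fun k => v k) ⟨i, hi⟩
      ⟨j, hj⟩ Q hQ
    have e : ∀ x, ∑ l : S, z (fun k : S => c k) (fun k : S => v k) l x = ∑ l ∈ S, z c v l x :=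
      fun x => Finset.sum_coe_sort S (fun l => z c v l x)
    simp only [e] at this
    exact this
  have hy : ∀ l, ∃ y : E (d + 2 + 2 * s), l ∉ S → ∀ x,
      min 1 (z c v i x) * min 1 (z c v j x) * min 1 (z c v l x)
      ≤ Real.exp (-δ) * Real.exp (-1 * ‖x - y‖ ^ 2) := by
    intro l
    by_cases hl : l ∈ S
    · exact ⟨0, fun h => absurd hl h⟩
    · obtain ⟨y, hy⟩ := cert_bound c v δ i j l (hcert l hl)
      exact ⟨y, fun _ => hy⟩
  choose y hy using hy
  have hi1 := zzF_integrable c v i j Finset.univ Q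
  have hi2 := zzF_integrable c v i j S Q
  have hi3 : Integrable (fun x => C * ∑ l ∈ Sᶜ, Real.exp (-δ) * Real.exp (-1 * ‖x - y l‖ ^ 2)) :=
    (integrable_finsetSum _ fun l _ => (gauss_integrable _ one_pos (y l)).const_mul _).const_mul _
  have hdiff : ∫ x, (z c v i x * z c v j x *
      (Q.eval (∑ l ∈ S, z c v l x) * Real.exp (-(∑ l ∈ S, z c v l x)))
      - C * ∑ l ∈ Sᶜ, Real.exp (-δ) * Real.exp (-1 * ‖x - y l‖ ^ 2)) ≤
      ∫ x, z c v i x * z c v j x *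
        (Q.eval (∑ l, z c v l x) * Real.exp (-(∑ l, z c v l x))) := by
    refine integral_mono (hi2.sub hi3) hi1 fun x => ?_
    have hsplit := Finset.sum_add_sum_compl S (fun l => z c v l x)
    have hcn : 0 ≤ ∑ l ∈ Sᶜ, z c v l x := Finset.sum_nonneg fun l _ => (z_pos _ _ _ _).le
    have hSn : z c v i x + z c v j x ≤ ∑ l ∈ S, z c v l x := by
      rw [← Finset.sum_pair (f := fun l => z c v l x) hij]
      exact Finset.sum_le_sum_of_subset_of_nonneg (by
        intro a ha; simp at ha; rcases ha with rfl | rfl <;> assumption)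
        (fun l _ _ => (z_pos _ _ _ _).le)
    have hzi := z_pos c v i x
    have hzj := z_pos c v j x
    have hl := hlip (∑ l ∈ S, z c v l x) (∑ l, z c v l x) (by linarith) (by linarith)
    have e : ∑ l, z c v l x - ∑ l ∈ S, z c v l x = ∑ l ∈ Sᶜ, z c v l x := by linarith
    rw [e] at hl
    have hexp : Real.exp (-(∑ l ∈ S, z c v l x) / 2)
        ≤ Real.exp (-z c v i x / 2) * Real.exp (-z c v j x / 2) := by
      rw [← Real.exp_add]; exact Real.exp_le_exp.2 (by linarith)
    have hm := min_sum_le Sᶜ (fun l => z c v l x) (fun l => (z_pos c v l x).le)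
    have hm0 : 0 ≤ ∑ l ∈ Sᶜ, min 1 (z c v l x) :=
      Finset.sum_nonneg fun l _ => le_min zero_le_one (z_pos c v l x).le
    have hmi := mul_exp_half_le _ hzi.le
    have hmj := mul_exp_half_le _ hzj.le
    have hmi0 : 0 ≤ min 1 (z c v i x) := le_min zero_le_one hzi.le
    have key : z c v i x * z c v j x * (C * min 1 (∑ l ∈ Sᶜ, z c v l x) *
        Real.exp (-(∑ l ∈ S, z c v l x) / 2))
        ≤ C * ∑ l ∈ Sᶜ, Real.exp (-δ) * Real.exp (-1 * ‖x - y l‖ ^ 2) := by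
      calc _ ≤ z c v i x * z c v j x * (C * (∑ l ∈ Sᶜ, min 1 (z c v l x)) *
              (Real.exp (-z c v i x / 2) * Real.exp (-z c v j x / 2))) := by gcongr
        _ = C * ((z c v i x * Real.exp (-z c v i x / 2)) * (z c v j x * Real.exp (-z c v j x / 2))
              * ∑ l ∈ Sᶜ, min 1 (z c v l x)) := by ring
        _ ≤ C * (min 1 (z c v i x) * min 1 (z c v j x) * ∑ l ∈ Sᶜ, min 1 (z c v l x)) := by
            gcongr
        _ ≤ _ := by
            rw [Finset.mul_sum]
            exact mul_le_mul_of_nonneg_left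
              (Finset.sum_le_sum fun l hl => hy l (by simpa using hl) x) hC.le
    have hl' := mul_le_mul_of_nonneg_left hl (mul_pos hzi hzj).le
    have hab := mul_le_mul_of_nonneg_left (neg_abs_le (Polynomial.eval (∑ l, z c v l x) Q * Real.exp (-∑ l, z c v l x) -
          Polynomial.eval (∑ l ∈ S, z c v l x) Q * Real.exp (-∑ l ∈ S, z c v l x))) (mul_pos hzi hzj).le
    simp only
    linarith
  rw [integral_sub hi2 hi3, integral_const_mul, integral_finsetSum _
    (fun l _ => (gauss_integrable _ one_pos (y l)).const_mul _)] at hdiff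
  simp only [integral_const_mul, gauss_integral _ one_pos, div_one, Finset.sum_const,
    nsmul_eq_mul] at hdiff
  have hcard : ((Sᶜ.card : ℕ) : ℝ) ≤ N + 1 := by
    have : Sᶜ.card ≤ N := by simpa using Finset.card_le_univ Sᶜ
    have : ((Sᶜ.card : ℕ) : ℝ) ≤ N := by exact_mod_cast this
    linarith
  have h1 : C * ((Sᶜ.card : ℝ) * (Real.exp (-δ) * Real.pi ^ (((d + 2 + 2 * s : ℕ) : ℝ) / 2)))
      ≤ C * ((N + 1) * (Real.exp (-δ) * Real.pi ^ (((d + 2 + 2 * s : ℕ) : ℝ) / 2))) := by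
    gcongr
  linarith

noncomputable def jt {N : ℕ} (d : ℕ) (D : Fin N → Fin N → ℝ) (c : Fin N → ℝ) (m : ℕ) : ℝ :=
  (-1) ^ m / ((m + 1).factorial : ℝ) * (Real.pi / ((m : ℝ) + 1)) ^ ((d : ℝ) / 2) *
    ∑ w : Fin (m + 1) → Fin N, G D c w

lemma integral_pow {N d : ℕ} (c : Fin N → ℝ) (v : Fin N → E d) (m : ℕ) :
    ∫ x, (∑ l, z c v l x) ^ (m + 1) =
      (∑ w : Fin (m + 1) → Fin N, G (fun i j => ‖v i - v j‖ ^ 2) c w)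
        * (Real.pi / ((m : ℝ) + 1)) ^ ((d : ℝ) / 2) := by
  simp only [Fintype.sum_pow]
  rw [integral_finsetSum _ (fun u _ => integrable_prod_z c v (by omega) _), Finset.sum_mul]
  refine Finset.sum_congr rfl fun u _ => ?_
  rw [integral_prod_z c v (by omega)]
  have : ((m + 1 : ℕ) : ℝ) = (m : ℝ) + 1 := by push_cast; ring
  rw [← this]

lemma J_eq {N d : ℕ} (c : Fin N → ℝ) (v : Fin N → E d) :
    HasSum (jt d (fun i j => ‖v i - v j‖ ^ 2) c)
      (∫ x, (1 - Real.exp (-(∑ l, z c v l x)))) := by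
  have hsum : ∀ K : ℝ, 0 ≤ K →
      Summable fun m : ℕ => |(-1) ^ m / ((m + 1).factorial : ℝ)| * K ^ m := by
    intro K hK
    refine Summable.of_nonneg_of_le (fun m => by positivity) (fun m => ?_)
      (Real.summable_pow_div_factorial K)
    rw [abs_div, abs_pow, abs_neg, abs_one, one_pow, abs_of_nonneg (by positivity), div_mul_eq_mul_div,
      one_mul]
    gcongr
    omega
  have hs : ∀ Z : ℝ, Summable fun m : ℕ => (-1) ^ m / ((m + 1).factorial : ℝ) * Z ^ m := by
    intro Z
    refine Summable.of_norm ((hsum |Z| (abs_nonneg _)).congr fun m => ?_)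
    rw [norm_mul, norm_pow, Real.norm_eq_abs, Real.norm_eq_abs]
  have hΦ : ∀ Z : ℝ, Z * (∑' m : ℕ, (-1) ^ m / ((m + 1).factorial : ℝ) * Z ^ m)
      = 1 - Real.exp (-Z) := by
    intro Z
    have h1 := (hasSum_nat_add_iff' 1).2 (hasSum_exp_neg Z)
    have h2 := (hs Z).hasSum.mul_left Z
    have h3 := h2.neg
    have h4 := hs_congr h1 (g := fun m => -(Z * ((-1) ^ m / ((m + 1).factorial : ℝ) * Z ^ m)))
      (fun m => by ring) rfl
    have := h3.unique h4
    simp at this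
    linarith
  have := swap (fun x => ∑ l, z c v l x) (fun x => ∑ l, z c v l x)
    (integrable_finsetSum _ fun l _ => z_integrable c v l) (sum_z_cont c v)
    (∑ l, Real.exp (c l)) (fun x => Finset.sum_nonneg fun l _ => (z_pos c v l x).le)
    (fun x => Finset.sum_le_sum fun l _ => z_le c v l x) _
    (hsum _ (Finset.sum_nonneg fun l _ => (Real.exp_pos _).le)) _ (fun Z => (hs Z).hasSum)
  simp only [hΦ, ← pow_succ', integral_pow] at this
  refine hs_congr this (fun m => ?_) rfl
  simp only [jt]; ring

noncomputable def jt' {N : ℕ} (d : ℕ) (D e : Fin N → Fin N → ℝ) (c : Fin N → ℝ) (m : ℕ) : ℝ :=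
  (-1) ^ m / ((m + 1).factorial : ℝ) * (Real.pi / ((m : ℝ) + 1)) ^ ((d : ℝ) / 2) *
    ∑ w : Fin (m + 1) → Fin N, G D c w * (-(1 / (2 * ((m : ℝ) + 1))) * ∑ a, ∑ b, e (w a) (w b))

lemma jt_deriv {N : ℕ} (d : ℕ) (D e : Fin N → Fin N → ℝ) (c : Fin N → ℝ) (m : ℕ) (t : ℝ) :
    HasDerivAt (fun t => jt d (fun i j => D i j + t * e i j) c m)
      (jt' d (fun i j => D i j + t * e i j) e c m) t := by
  unfold jt jt'
  refine HasDerivAt.const_mul _ (HasDerivAt.fun_sum fun w _ => ?_)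
  unfold G
  refine HasDerivAt.exp ?_
  have h1 : HasDerivAt (fun t : ℝ => ∑ a, ∑ b, (D (w a) (w b) + t * e (w a) (w b)))
      (∑ a, ∑ b, e (w a) (w b)) t := by
    refine HasDerivAt.fun_sum fun a _ => HasDerivAt.fun_sum fun b _ => ?_
    simpa using ((hasDerivAt_id t).mul_const (e (w a) (w b))).const_add (D (w a) (w b))
  have h2 := (h1.const_mul (1 / (2 * ((m + 1 : ℕ) : ℝ)))).const_sub (∑ a, c (w a))
  refine h2.congr_deriv ?_
  push_cast; ring

lemma abs_double_sum_le {N : ℕ} (e : Fin N → Fin N → ℝ) (M : ℝ) (he : ∀ i j, |e i j| ≤ M)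
    (m : ℕ) (w : Fin (m + 1) → Fin N) :
    |∑ a, ∑ b, e (w a) (w b)| ≤ ((m : ℝ) + 1) * (((m : ℝ) + 1) * M) := by
  refine (Finset.abs_sum_le_sum_abs _ _).trans ?_
  have : ∀ a ∈ (Finset.univ : Finset (Fin (m + 1))), |∑ b, e (w a) (w b)| ≤ ((m : ℝ) + 1) * M := by
    intro a _
    refine (Finset.abs_sum_le_sum_abs _ _).trans ?_
    refine (Finset.sum_le_sum fun b _ => he (w a) (w b)).trans ?_
    simp
  refine (Finset.sum_le_sum this).trans ?_
  simp

lemma jt'_bound {N : ℕ} (d : ℕ) (D e : Fin N → Fin N → ℝ) (c : Fin N → ℝ) (m : ℕ) (M : ℝ)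
    (hM : 0 ≤ M) (hD : ∀ i j, |D i j| ≤ M) (he : ∀ i j, |e i j| ≤ M) (hc : ∀ i, |c i| ≤ M) :
    ‖jt' d D e c m‖ ≤ (Real.pi ^ ((d : ℝ) / 2) * M * (N * Real.exp (2 * M))) *
      ((N * Real.exp (2 * M)) ^ m / m.factorial) := by
  have hpi := Real.pi_pos
  unfold jt'
  rw [norm_mul, norm_mul, norm_div, norm_pow, norm_neg, norm_one, one_pow]
  have h1 : ‖((m + 1).factorial : ℝ)‖ = ((m : ℝ) + 1) * m.factorial := by
    rw [Real.norm_eq_abs, abs_of_nonneg (by positivity), Nat.factorial_succ]; push_cast; ring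
  have h2 : ‖(Real.pi / ((m : ℝ) + 1)) ^ ((d : ℝ) / 2)‖ ≤ Real.pi ^ ((d : ℝ) / 2) := by
    rw [Real.norm_eq_abs, abs_of_nonneg (by positivity)]
    gcongr
    exact div_le_self hpi.le (by linarith [(Nat.cast_nonneg m : (0 : ℝ) ≤ m)])
  have h3 : ∀ w : Fin (m + 1) → Fin N, ‖G D c w * (-(1 / (2 * ((m : ℝ) + 1))) *
      ∑ a, ∑ b, e (w a) (w b))‖ ≤ Real.exp (2 * M) ^ (m + 1) * (((m : ℝ) + 1) * M) := by
    intro w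
    have hG : G D c w ≤ Real.exp (2 * M) ^ (m + 1) := by
      unfold G
      rw [← Real.exp_nat_mul]
      refine Real.exp_le_exp.2 ?_
      have hA : ∑ a, c (w a) ≤ ((m : ℝ) + 1) * M := by
        refine (Finset.sum_le_sum fun a _ => (le_abs_self _).trans (hc (w a))).trans ?_
        simp
      have hB := abs_double_sum_le D M hD m w
      have hB' := neg_abs_le (∑ a, ∑ b, D (w a) (w b))
      have hC : -(((m : ℝ) + 1) * M) ≤ (1 / (2 * ((m + 1 : ℕ) : ℝ))) * ∑ a, ∑ b, D (w a) (w b) := by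
        calc -(((m : ℝ) + 1) * M) ≤ (1 / (2 * ((m + 1 : ℕ) : ℝ))) * -(((m : ℝ) + 1) * (((m : ℝ) + 1) * M)) := by
              push_cast
              have : (1 / (2 * ((m : ℝ) + 1))) * -(((m : ℝ) + 1) * (((m : ℝ) + 1) * M))
                = -(((m : ℝ) + 1) * M) / 2 := by
                field_simp
              rw [this]
              have : 0 ≤ ((m : ℝ) + 1) * M := by positivity
              linarith
          _ ≤ _ := by
              gcongr
              linarith
      push_cast at hC ⊢
      linarith
    rw [norm_mul, norm_mul, Real.norm_eq_abs (G D c w), abs_of_pos (show 0 < G D c w from Real.exp_pos _)]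
    refine mul_le_mul hG ?_ (by positivity) (by positivity)
    have hE := abs_double_sum_le e M he m w
    rw [norm_neg, Real.norm_eq_abs, Real.norm_eq_abs, abs_of_nonneg (by positivity)]
    calc _ ≤ (1 / (2 * ((m : ℝ) + 1))) * (((m : ℝ) + 1) * (((m : ℝ) + 1) * M)) := by gcongr
      _ = (((m : ℝ) + 1) * M) / 2 := by field_simp
      _ ≤ _ := by
        have : 0 ≤ ((m : ℝ) + 1) * M := by positivity
        linarith
  have h4 : ‖∑ w : Fin (m + 1) → Fin N, G D c w * (-(1 / (2 * ((m : ℝ) + 1))) *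
      ∑ a, ∑ b, e (w a) (w b))‖ ≤ (N : ℝ) ^ (m + 1) * (Real.exp (2 * M) ^ (m + 1) * (((m : ℝ) + 1) * M)) := by
    refine (norm_sum_le _ _).trans ((Finset.sum_le_sum fun w _ => h3 w).trans ?_)
    simp
  rw [h1]
  calc _ ≤ 1 / (((m : ℝ) + 1) * m.factorial) * Real.pi ^ ((d : ℝ) / 2) *
        ((N : ℝ) ^ (m + 1) * (Real.exp (2 * M) ^ (m + 1) * (((m : ℝ) + 1) * M))) := by gcongr
    _ = _ := by
      have : (m.factorial : ℝ) ≠ 0 := by positivity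
      have : ((m : ℝ) + 1) ≠ 0 := by positivity
      field_simp
      ring

lemma jt'_hasSum {N : ℕ} (d s : ℕ) (e : Fin N → Fin N → ℝ) (he : ∀ i, e i i = 0)
    (c : Fin N → ℝ) (v : Fin N → E (d + 2 + 2 * s)) (Q : Polynomial ℝ)
    (hQ : ∀ Z : ℝ, HasSum (fun m : ℕ => co s 2 m * Z ^ m) (Q.eval Z * Real.exp (-Z))) :
    HasSum (jt' d (fun i j => ‖v i - v j‖ ^ 2) e c)
      ((2 * Real.pi ^ (s + 1))⁻¹ * ∑ i, ∑ j, e i j * ∫ x, z c v i x * z c v j x *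
        (Q.eval (∑ l, z c v l x) * Real.exp (-(∑ l, z c v l x)))) := by
  have hpi := Real.pi_pos
  have h0 : jt' d (fun i j => ‖v i - v j‖ ^ 2) e c 0 = 0 := by
    simp [jt', he]
  have hs : ∀ i j, HasSum (fun m => co s 2 m * ∫ x, z c v i x * z c v j x * (∑ l, z c v l x) ^ m)
      (∫ x, z c v i x * z c v j x *
        (Q.eval (∑ l, z c v l x) * Real.exp (-(∑ l, z c v l x)))) := fun i j =>
    swap _ _ (zz_integrable c v i j) (sum_z_cont c v) (∑ l, Real.exp (c l))
      (fun x => Finset.sum_nonneg fun l _ => (z_pos c v l x).le)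
      (fun x => Finset.sum_le_sum fun l _ => z_le c v l x) (co s 2)
      (co_abs_summable s 2 _ (Finset.sum_nonneg fun l _ => (Real.exp_pos _).le)) _ hQ
  have hs2 := (hasSum_sum fun i (_ : i ∈ Finset.univ) => hasSum_sum fun j (_ : j ∈ Finset.univ) =>
    (hs i j).mul_left (e i j)).mul_left ((2 * Real.pi ^ (s + 1))⁻¹)
  rw [← hasSum_nat_add_iff' 1]
  simp only [Finset.range_one, Finset.sum_singleton, h0, sub_zero]
  refine hs_congr hs2 (fun m => ?_) rfl
  have hint : ∀ i j, Integrable (fun x => z c v i x * z c v j x * (∑ l, z c v l x) ^ m) := by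
    intro i j
    have h : ∀ x, z c v i x * z c v j x * (∑ l, z c v l x) ^ m = _ :=
      fun x => pair_words m (fun l => z c v l x) i j
    simp only [h]
    exact integrable_finsetSum _ (fun u _ => integrable_prod_z c v (by omega) _)
  have hw : (∑ w : Fin (m + 2) → Fin N, (∑ a, ∑ b, e (w a) (w b)) *
        G (fun i j => ‖v i - v j‖ ^ 2) c w) * (Real.pi / ((m : ℝ) + 2)) ^ (((d + 2 + 2 * s : ℕ) : ℝ) / 2)
      = (m + 2) * (m + 1) * ∑ i, ∑ j, e i j *
        ∫ x, z c v i x * z c v j x * (∑ l, z c v l x) ^ m := by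
    have e1 : ∀ x, _ := fun x => words_two m e he (fun l => z c v l x)
    have e2 : ∫ x, (∑ w : Fin (m + 2) → Fin N, (∑ a, ∑ b, e (w a) (w b)) * ∏ a, z c v (w a) x)
        = ∫ x, (((m : ℝ) + 2) * (m + 1) * ∑ i, ∑ j, e i j * (z c v i x * z c v j x * (∑ i, z c v i x) ^ m)) := by
      congr 1; funext x; exact e1 x
    rw [integral_finsetSum _ (fun w _ => (integrable_prod_z c v (by omega) w).const_mul _),
      integral_const_mul, integral_finsetSum _ (fun i _ => integrable_finsetSum _
        fun j _ => (hint i j).const_mul _)] at e2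
    simp only [integral_const_mul] at e2
    have e3 : ∀ i, ∫ x, ∑ j, e i j * (z c v i x * z c v j x * (∑ i, z c v i x) ^ m)
        = ∑ j, e i j * ∫ x, z c v i x * z c v j x * (∑ l, z c v l x) ^ m := by
      intro i
      rw [integral_finsetSum _ fun j _ => (hint i j).const_mul _]
      simp only [integral_const_mul]
    simp only [e3] at e2
    rw [← e2, Finset.sum_mul]
    refine Finset.sum_congr rfl fun w _ => ?_
    rw [integral_prod_z c v (by omega), ← mul_assoc]
    have : ((m + 2 : ℕ) : ℝ) = (m : ℝ) + 2 := by push_cast; ring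
    rw [← this]
  have hp := pow_id ((m : ℝ) + 2) (by positivity) d (s + 1)
  have hn : d + 2 * (s + 1) = d + 2 + 2 * s := by ring
  rw [hn] at hp
  have hk : ((m + 1 : ℕ) : ℝ) + 1 = (m : ℝ) + 2 := by push_cast; ring
  have hsw : ∑ w : Fin (m + 1 + 1) → Fin N, G (fun i j => ‖v i - v j‖ ^ 2) c w *
      (-(1 / (2 * (((m + 1 : ℕ) : ℝ) + 1))) * ∑ a, ∑ b, e (w a) (w b))
      = -(1 / (2 * ((m : ℝ) + 2))) * ∑ w : Fin (m + 2) → Fin N, (∑ a, ∑ b, e (w a) (w b)) *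
        G (fun i j => ‖v i - v j‖ ^ 2) c w := by
    rw [hk, Finset.mul_sum]
    refine Finset.sum_congr rfl fun w _ => ?_
    ring
  unfold jt'
  rw [hsw, hk]
  have hI : ∑ i, ∑ j, e i j * (co s 2 m * ∫ x, z c v i x * z c v j x * (∑ l, z c v l x) ^ m)
      = co s 2 m * ∑ i, ∑ j, e i j * ∫ x, z c v i x * z c v j x * (∑ l, z c v l x) ^ m := by
    rw [Finset.mul_sum]
    refine Finset.sum_congr rfl fun i _ => ?_
    rw [Finset.mul_sum]
    refine Finset.sum_congr rfl fun j _ => ?_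
    ring
  rw [hI]
  set I := ∑ i, ∑ j, e i j * ∫ x, z c v i x * z c v j x * (∑ l, z c v l x) ^ m
  set A := ∑ w : Fin (m + 2) → Fin N, (∑ a, ∑ b, e (w a) (w b)) * G (fun i j => ‖v i - v j‖ ^ 2) c w
  set P := (Real.pi / ((m : ℝ) + 2)) ^ (((d + 2 + 2 * s : ℕ) : ℝ) / 2)
  have hI' : I = A * P / ((m + 2) * (m + 1)) := by
    rw [hw]; field_simp
  have hP : (Real.pi / ((m : ℝ) + 2)) ^ ((d : ℝ) / 2) = (m + 2) ^ (s + 1) * P / Real.pi ^ (s + 1) := by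
    rw [hp]; field_simp
  rw [hI', hP]
  simp only [co, Nat.factorial_succ]
  push_cast
  have : (m.factorial : ℝ) ≠ 0 := by positivity
  field_simp
  ring

lemma exists_path {N : ℕ} (d : ℕ) (p q : Fin N → E d) (t : ℝ) (h0 : 0 ≤ t) (h1 : t ≤ 1) :
    ∃ v : Fin N → E (d + 2 + 2 * d), ∀ i j, ‖v i - v j‖ ^ 2
      = ‖p i - p j‖ ^ 2 + t * (‖q i - q j‖ ^ 2 - ‖p i - p j‖ ^ 2) := by
  have hfr : Module.finrank ℝ (WithLp 2 (E d × E d)) ≤ d + 2 + 2 * d := by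
    rw [(WithLp.linearEquiv 2 ℝ (E d × E d)).finrank_eq]
    simp; omega
  obtain ⟨f, hf⟩ := exists_isometry_s1 (V := WithLp 2 (E d × E d)) _ hfr
  refine ⟨fun i => f (WithLp.toLp 2 (Real.sqrt (1 - t) • p i, Real.sqrt t • q i)), fun i j => ?_⟩
  rw [← map_sub, hf, WithLp.prod_norm_sq_eq_of_L2]
  simp only [WithLp.sub_fst, WithLp.sub_snd]
  change ‖Real.sqrt (1 - t) • p i - Real.sqrt (1 - t) • p j‖ ^ 2
    + ‖Real.sqrt t • q i - Real.sqrt t • q j‖ ^ 2 = _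
  rw [← smul_sub, ← smul_sub, norm_smul, norm_smul, mul_pow, mul_pow, Real.norm_eq_abs,
    Real.norm_eq_abs, sq_abs, sq_abs, Real.sq_sqrt (by linarith), Real.sq_sqrt h0]
  ring

lemma core (N d : ℕ) : ∃ C : ℝ, 0 < C ∧ ∀ (p q : Fin N → E d) (c : Fin N → ℝ) (δ : ℝ),
    (∀ i j, ‖p i - p j‖ ^ 2 ≤ ‖q i - q j‖ ^ 2) →
    (∀ i j, i ≠ j → ∃ S : Finset (Fin N), i ∈ S ∧ j ∈ S ∧ S.card ≤ d + 3 ∧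
      ∀ l, l ∉ S → Cert (fun i j => ‖p i - p j‖ ^ 2) c δ i j l) →
    (∫ x, (1 - Real.exp (-(∑ l, z c p l x))))
      - C * Real.exp (-δ) * ∑ i, ∑ j, (‖q i - q j‖ ^ 2 - ‖p i - p j‖ ^ 2)
      ≤ ∫ x, (1 - Real.exp (-(∑ l, z c q l x))) := by
  obtain ⟨C, Q, hC, hQ, hpair⟩ := pair_bound_s1 N d d
  have hpi := Real.pi_pos
  refine ⟨(2 * Real.pi ^ (d + 1))⁻¹ * C, by positivity, ?_⟩
  intro p q c δ hexp hS
  set D : Fin N → Fin N → ℝ := fun i j => ‖p i - p j‖ ^ 2 with hD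
  set e : Fin N → Fin N → ℝ := fun i j => ‖q i - q j‖ ^ 2 - ‖p i - p j‖ ^ 2 with he
  have he0 : ∀ i, e i i = 0 := fun i => by simp [he]
  have hepos : ∀ i j, 0 ≤ e i j := fun i j => sub_nonneg.2 (hexp i j)
  set J : ℝ → ℝ := fun t => ∑' m, jt d (fun i j => D i j + t * e i j) c m with hJ
  set J' : ℝ → ℝ := fun t => ∑' m, jt' d (fun i j => D i j + t * e i j) e c m with hJ'
  have hJ0 : J 0 = ∫ x, (1 - Real.exp (-(∑ l, z c p l x))) := by
    simp only [hJ, zero_mul, add_zero]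
    exact (J_eq c p).tsum_eq
  have hJ1 : J 1 = ∫ x, (1 - Real.exp (-(∑ l, z c q l x))) := by
    have : (fun i j => D i j + 1 * e i j) = fun i j => ‖q i - q j‖ ^ 2 := by
      funext i j; simp [hD, he]
    simp only [hJ, this]
    exact (J_eq c q).tsum_eq
  obtain ⟨M, hM0, hMD, hMe, hMc⟩ : ∃ M : ℝ, 0 ≤ M ∧ (∀ t ∈ Set.Ioo (-2 : ℝ) 2, ∀ i j,
      |D i j + t * e i j| ≤ M) ∧ (∀ i j, |e i j| ≤ M) ∧ ∀ i, |c i| ≤ M := by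
    have hs1 : ∀ i j, |D i j| ≤ ∑ i, ∑ j, |D i j| := fun i j =>
      (Finset.single_le_sum (f := fun j => |D i j|) (fun j _ => abs_nonneg _)
        (Finset.mem_univ j)).trans (Finset.single_le_sum (f := fun i => ∑ j, |D i j|)
        (fun i _ => Finset.sum_nonneg fun j _ => abs_nonneg _) (Finset.mem_univ i))
    have hs2 : ∀ i j, |e i j| ≤ ∑ i, ∑ j, |e i j| := fun i j =>
      (Finset.single_le_sum (f := fun j => |e i j|) (fun j _ => abs_nonneg _)
        (Finset.mem_univ j)).trans (Finset.single_le_sum (f := fun i => ∑ j, |e i j|)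
        (fun i _ => Finset.sum_nonneg fun j _ => abs_nonneg _) (Finset.mem_univ i))
    have hs3 : ∀ i, |c i| ≤ ∑ i, |c i| := fun i =>
      Finset.single_le_sum (f := fun j => |c j|) (fun j _ => abs_nonneg _) (Finset.mem_univ i)
    have h1 : 0 ≤ ∑ i, ∑ j, |D i j| :=
      Finset.sum_nonneg fun i _ => Finset.sum_nonneg fun j _ => abs_nonneg _
    have h2 : 0 ≤ ∑ i, ∑ j, |e i j| :=
      Finset.sum_nonneg fun i _ => Finset.sum_nonneg fun j _ => abs_nonneg _
    have h3 : 0 ≤ ∑ i, |c i| := Finset.sum_nonneg fun i _ => abs_nonneg _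
    refine ⟨∑ i, ∑ j, |D i j| + 2 * ∑ i, ∑ j, |e i j| + ∑ i, |c i|, by linarith, ?_, ?_, ?_⟩
    · intro t ht i j
      have ht' : |t| ≤ 2 := abs_le.2 ⟨ht.1.le, ht.2.le⟩
      have ha := abs_add_le (D i j) (t * e i j)
      rw [abs_mul] at ha
      have hb : |t| * |e i j| ≤ 2 * |e i j| := by gcongr
      linarith [hs1 i j, hs2 i j]
    · intro i j; linarith [hs2 i j]
    · intro i; linarith [hs3 i]
  have hderiv : ∀ t ∈ Set.Ioo (-2 : ℝ) 2, HasDerivAt J (J' t) t := by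
    intro t ht
    refine hasDerivAt_tsum_of_isPreconnected (t := Set.Ioo (-2 : ℝ) 2) (y₀ := 0)
      ((Real.summable_pow_div_factorial (N * Real.exp (2 * M))).mul_left
        (Real.pi ^ ((d : ℝ) / 2) * M * (N * Real.exp (2 * M))))
      isOpen_Ioo isPreconnected_Ioo (fun m y _ => jt_deriv d D e c m y)
      (fun m y hy => jt'_bound d _ e c m M hM0 (hMD y hy) hMe hMc) (by constructor <;> norm_num)
      ?_ ht
    simp only [zero_mul, add_zero]
    exact (J_eq c p).summable
  obtain ⟨t, ht, hslope⟩ := exists_hasDerivAt_eq_slope J J' (a := 0) (b := 1) one_pos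
    (fun x hx => (hderiv x ⟨by linarith [hx.1], by linarith [hx.2]⟩).continuousAt.continuousWithinAt)
    (fun x hx => hderiv x ⟨by linarith [hx.1], by linarith [hx.2]⟩)
  rw [hJ0, hJ1] at hslope
  obtain ⟨v, hv⟩ := exists_path d p q t ht.1.le ht.2.le
  have hDt : (fun i j => D i j + t * e i j) = fun i j => ‖v i - v j‖ ^ 2 := by
    funext i j; rw [hv]
  have hJt : J' t = (2 * Real.pi ^ (d + 1))⁻¹ * ∑ i, ∑ j, e i j * ∫ x, z c v i x * z c v j x *
        (Q.eval (∑ l, z c v l x) * Real.exp (-(∑ l, z c v l x))) := by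
    simp only [hJ', hDt]
    exact (jt'_hasSum d d e he0 c v Q hQ).tsum_eq
  have hlow : ∑ i, ∑ j, e i j * -(C * Real.exp (-δ)) ≤
      ∑ i, ∑ j, e i j * ∫ x, z c v i x * z c v j x *
        (Q.eval (∑ l, z c v l x) * Real.exp (-(∑ l, z c v l x))) := by
    refine Finset.sum_le_sum fun i _ => Finset.sum_le_sum fun j _ => ?_
    by_cases hij : i = j
    · subst hij; simp [he0]
    · obtain ⟨S, hi, hj, hc, hl⟩ := hS i j hij
      refine mul_le_mul_of_nonneg_left ?_ (hepos i j)
      refine hpair c v δ i j S hij hi hj hc fun l hlS => (hl l hlS).mono fun a b => ?_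
      rw [hv]
      have := mul_nonneg ht.1.le (hepos a b)
      simp only [he, hD] at this ⊢
      linarith
  simp only [← Finset.sum_mul] at hlow
  have hlow2 := mul_le_mul_of_nonneg_left hlow (show 0 ≤ (2 * Real.pi ^ (d + 1))⁻¹ by positivity)
  rw [← hJt, hslope] at hlow2
  simp only [sub_zero, div_one] at hlow2
  linarith

lemma exists_cert_aux {d : ℕ} (τ : Fin 3 → E d) (ρ : Fin 3 → ℝ)
    (h : ¬ ∃ x, ∀ a, ‖x - τ a‖ ^ 2 < ρ a) :
    ∃ w : Fin 3 → ℝ, (∀ a, 0 ≤ w a) ∧ ∑ a, w a = 1 ∧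
      0 ≤ (1 / 2) * ∑ a, ∑ b, w a * w b * ‖τ a - τ b‖ ^ 2 - ∑ a, w a * ρ a := by
  set φ : (Fin 3 → ℝ) → ℝ := fun w =>
    (1 / 2) * ∑ a, ∑ b, w a * w b * ‖τ a - τ b‖ ^ 2 - ∑ a, w a * ρ a with hφ
  have hcont : Continuous φ := by simp only [hφ]; fun_prop
  obtain ⟨w, hw, hmax⟩ := (isCompact_stdSimplex ℝ (Fin 3)).exists_isMaxOn
    ⟨_, single_mem_stdSimplex ℝ (0 : Fin 3)⟩ hcont.continuousOn
  refine ⟨w, hw.1, hw.2, ?_⟩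
  by_contra hneg
  push Not at hneg
  change φ w < 0 at hneg
  apply h
  refine ⟨∑ a, w a • τ a, fun k => ?_⟩
  set x := ∑ a, w a • τ a with hx
  have hvar : ∀ u : Fin 3 → ℝ, ∑ a, u a = 1 →
      φ u = ∑ a, u a * (‖x - τ a‖ ^ 2 - ρ a) - ‖x - ∑ a, u a • τ a‖ ^ 2 := by
    intro u hu
    have := variance_id u 1 hu one_ne_zero τ x
    simp only [inv_one, one_smul, one_mul, mul_one] at this
    simp only [hφ, mul_sub, Finset.sum_sub_distrib]
    linarith
  have hφw : φ w = ∑ a, w a * (‖x - τ a‖ ^ 2 - ρ a) := by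
    rw [hvar w hw.2, ← hx]; simp
  have hs : ∀ s : ℝ, 0 < s → s ≤ 1 → (‖x - τ k‖ ^ 2 - ρ k) - φ w ≤ s * ‖x - τ k‖ ^ 2 := by
    intro s hs0 hs1
    set u : Fin 3 → ℝ := (1 - s) • w + s • Pi.single k 1 with hu
    have hus : u ∈ stdSimplex ℝ (Fin 3) :=
      convex_stdSimplex ℝ (Fin 3) hw (single_mem_stdSimplex ℝ k) (by linarith) hs0.le (by ring)
    have h1 : φ u ≤ φ w := hmax hus
    rw [hvar u hus.2] at h1
    have e1 : ∑ a, u a * (‖x - τ a‖ ^ 2 - ρ a) = (1 - s) * φ w + s * (‖x - τ k‖ ^ 2 - ρ k) := by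
      rw [hφw, Finset.mul_sum]
      simp only [hu, Pi.add_apply, Pi.smul_apply, smul_eq_mul, add_mul, Finset.sum_add_distrib]
      congr 1
      · refine Finset.sum_congr rfl fun a _ => by ring
      · rw [Finset.sum_eq_single k]
        · simp
        · intro b _ hb; simp [hb]
        · simp
    have e2 : x - ∑ a, u a • τ a = s • (x - τ k) := by
      simp only [hu, Pi.add_apply, Pi.smul_apply, smul_eq_mul, add_smul, Finset.sum_add_distrib,
        mul_smul, ← Finset.smul_sum]
      rw [← hx, Finset.sum_eq_single k]
      · simp only [Pi.single_eq_same, one_smul]; module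
      · intro b _ hb; simp [hb]
      · simp
    rw [e1, e2, norm_smul, mul_pow, Real.norm_eq_abs, sq_abs] at h1
    have : s * ((‖x - τ k‖ ^ 2 - ρ k) - φ w) ≤ s * (s * ‖x - τ k‖ ^ 2) := by linarith
    exact le_of_mul_le_mul_left this hs0
  by_contra hge
  push Not at hge
  set m := ‖x - τ k‖ ^ 2
  have hm : 0 ≤ m := sq_nonneg _
  have h2 := hs (min 1 (-φ w / (2 * (m + 1)))) (lt_min one_pos (by apply div_pos <;> linarith))
    (min_le_left _ _)
  have h3 : min 1 (-φ w / (2 * (m + 1))) * m ≤ (-φ w / (2 * (m + 1))) * m :=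
    mul_le_mul_of_nonneg_right (min_le_right _ _) hm
  have h4 : (-φ w / (2 * (m + 1))) * m ≤ -φ w / 2 := by
    rw [div_mul_eq_mul_div, div_le_div_iff₀ (by positivity) (by norm_num)]
    nlinarith
  linarith

open Filter Topology in
lemma lim_I {N d : ℕ} [Nontrivial (E d)] (b : Fin N → ℝ) (p : Fin N → E d) :
    Tendsto (fun k : ℕ => ∫ y, (1 - Real.exp (-(∑ l, Real.exp (((k : ℝ) + 1) * (b l - ‖y - p l‖ ^ 2))))))
      atTop (𝓝 (volume.real {y : E d | ∃ i, ‖y - p i‖ ^ 2 < b i})) := by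
  set U := {y : E d | ∃ i, ‖y - p i‖ ^ 2 < b i} with hU
  have hUo : IsOpen U := by
    have : U = ⋃ i, {y : E d | ‖y - p i‖ ^ 2 < b i} := by ext y; simp [hU]
    rw [this]
    exact isOpen_iUnion fun i => isOpen_lt (by fun_prop) (by fun_prop)
  rw [← integral_indicator_one hUo.measurableSet]
  refine tendsto_integral_of_dominated_convergence (fun y => ∑ l, z b p l y) ?_ ?_ ?_ ?_
  · intro k
    apply Continuous.aestronglyMeasurable
    fun_prop
  · exact integrable_finset_sum _ fun l _ => z_integrable b p l
  · intro k
    refine Filter.Eventually.of_forall fun y => ?_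
    set Z := ∑ l, Real.exp (((k : ℝ) + 1) * (b l - ‖y - p l‖ ^ 2)) with hZ
    have hZ0 : 0 ≤ Z := Finset.sum_nonneg fun l _ => (Real.exp_pos _).le
    have h1 : Real.exp (-Z) ≤ 1 := Real.exp_le_one_iff.2 (by linarith)
    rw [Real.norm_eq_abs, abs_of_nonneg (by linarith)]
    have h2 : 1 - Real.exp (-Z) ≤ min 1 Z :=
      le_min (by linarith [Real.exp_pos (-Z)]) (by linarith [Real.add_one_le_exp (-Z)])
    refine h2.trans ((min_sum_le _ _ fun l => (Real.exp_pos _).le).trans ?_)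
    refine Finset.sum_le_sum fun l _ => ?_
    unfold z
    rcases le_total (b l - ‖y - p l‖ ^ 2) 0 with h | h
    · refine (min_le_right _ _).trans (Real.exp_le_exp.2 ?_)
      have hk : (0 : ℝ) ≤ k := Nat.cast_nonneg k
      nlinarith
    · exact (min_le_left _ _).trans (Real.one_le_exp h)
  · have hnull : ∀ᵐ y : E d, ∀ l, ‖y - p l‖ ^ 2 ≠ b l := by
      rw [ae_all_iff]
      intro l
      have h0 := Measure.addHaar_sphere (volume : Measure (E d)) (p l) (Real.sqrt (b l))
      refine measure_mono_null ?_ h0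
      intro y hy
      simp only [Set.mem_compl_iff, Set.mem_setOf_eq, not_not, ne_eq] at hy
      rw [mem_sphere, dist_eq_norm, ← hy, Real.sqrt_sq (norm_nonneg _)]
    filter_upwards [hnull] with y hy
    have hk : Tendsto (fun k : ℕ => (k : ℝ) + 1) atTop atTop :=
      tendsto_atTop_add_const_right _ _ tendsto_natCast_atTop_atTop
    by_cases hyU : y ∈ U
    · rw [Set.indicator_of_mem hyU]
      obtain ⟨i, hi⟩ := hyU
      have hi' : 0 < b i - ‖y - p i‖ ^ 2 := by linarith
      have h1 : Tendsto (fun k : ℕ => Real.exp (((k : ℝ) + 1) * (b i - ‖y - p i‖ ^ 2))) atTop atTop :=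
        Real.tendsto_exp_atTop.comp (hk.atTop_mul_const hi')
      have h2 : Tendsto (fun k : ℕ => ∑ l, Real.exp (((k : ℝ) + 1) * (b l - ‖y - p l‖ ^ 2)))
          atTop atTop := tendsto_atTop_mono (fun k =>
            Finset.single_le_sum (f := fun l => Real.exp (((k : ℝ) + 1) * (b l - ‖y - p l‖ ^ 2)))
            (fun l _ => (Real.exp_pos _).le) (Finset.mem_univ i)) h1
      have h3 := (Real.tendsto_exp_neg_atTop_nhds_zero.comp h2).const_sub 1
      simpa [Function.comp_def] using h3
    · rw [Set.indicator_of_notMem hyU]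
      have h2 : Tendsto (fun k : ℕ => ∑ l, Real.exp (((k : ℝ) + 1) * (b l - ‖y - p l‖ ^ 2)))
          atTop (𝓝 (∑ l : Fin N, (0 : ℝ))) := by
        refine tendsto_finset_sum _ fun l _ => ?_
        have hl : b l - ‖y - p l‖ ^ 2 < 0 := by
          have h3 : ¬ ‖y - p l‖ ^ 2 < b l := fun h => hyU ⟨l, h⟩
          have h4 := hy l
          push Not at h3
          have := lt_of_le_of_ne h3 (Ne.symm h4)
          linarith
        exact Real.tendsto_exp_atBot.comp (hk.atTop_mul_const_of_neg hl)
      simp only [Finset.sum_const_zero] at h2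
      have h3 := ((Real.continuous_exp.tendsto _).comp h2.neg).const_sub 1
      simpa [Function.comp_def] using h3

lemma scale_I {N d : ℕ} (b : Fin N → ℝ) (p : Fin N → E d) (s : ℝ) (hs : 0 < s) :
    ∫ y, (1 - Real.exp (-(∑ l, Real.exp (s ^ 2 * (b l - ‖y - p l‖ ^ 2)))))
      = (s ^ d)⁻¹ * ∫ x, (1 - Real.exp (-(∑ l, z (fun l => s ^ 2 * b l) (fun l => s • p l) l x))) := by
  have h := Measure.integral_comp_smul (volume : Measure (E d)) (fun x =>
    (1 - Real.exp (-(∑ l, z (fun l => s ^ 2 * b l) (fun l => s • p l) l x)))) s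
  rw [abs_of_pos (by positivity), smul_eq_mul] at h
  simp only [finrank_euclideanSpace, Fintype.card_fin] at h
  rw [← h]
  congr 1
  funext y
  congr 4
  funext l
  unfold z
  rw [← smul_sub, norm_smul, mul_pow, Real.norm_eq_abs, sq_abs]
  congr 1
  ring

lemma step_I {N d : ℕ} (p q : Fin N → E d) (r : Fin N → ℝ)
    (hexp : ∀ i j, ‖p i - p j‖ ≤ ‖q i - q j‖)
    (hS : ∀ i j, i ≠ j → ∃ S : Finset (Fin N), i ∈ S ∧ j ∈ S ∧ S.card ≤ d + 3 ∧
      ∀ l, l ∉ S → ¬ ∃ x, ∀ a : Fin 3, ‖x - p (![i, j, l] a)‖ ^ 2 < (r (![i, j, l] a)) ^ 2)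
    (ε : ℝ) :
    ∃ C : ℝ, 0 ≤ C ∧ ∀ s : ℝ, 1 ≤ s →
    (∫ y, (1 - Real.exp (-(∑ l, Real.exp (s ^ 2 * (r l ^ 2 - ε - ‖y - p l‖ ^ 2))))))
      - C * (s ^ 2 * Real.exp (-(s ^ 2 * ε)))
      ≤ ∫ y, (1 - Real.exp (-(∑ l, Real.exp (s ^ 2 * (r l ^ 2 - ε - ‖y - q l‖ ^ 2))))) := by
  obtain ⟨C, hC, hcore⟩ := core N d
  have hexp2 : ∀ i j, ‖p i - p j‖ ^ 2 ≤ ‖q i - q j‖ ^ 2 := fun i j =>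
    pow_le_pow_left₀ (norm_nonneg _) (hexp i j) 2
  have hE : 0 ≤ ∑ i, ∑ j, (‖q i - q j‖ ^ 2 - ‖p i - p j‖ ^ 2) :=
    Finset.sum_nonneg fun i _ => Finset.sum_nonneg fun j _ => sub_nonneg.2 (hexp2 i j)
  refine ⟨C * ∑ i, ∑ j, (‖q i - q j‖ ^ 2 - ‖p i - p j‖ ^ 2), by positivity, fun s hs => ?_⟩
  have hs0 : 0 < s := by linarith
  have hn : ∀ (v : Fin N → E d) i j, ‖s • v i - s • v j‖ ^ 2 = s ^ 2 * ‖v i - v j‖ ^ 2 := by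
    intro v i j
    rw [← smul_sub, norm_smul, mul_pow, Real.norm_eq_abs, sq_abs]
  have h := hcore (fun l => s • p l) (fun l => s • q l) (fun l => s ^ 2 * (r l ^ 2 - ε)) (s ^ 2 * ε)
    (fun i j => by
      simp only [hn]
      exact mul_le_mul_of_nonneg_left (hexp2 i j) (by positivity))
    (fun i j hij => by
      obtain ⟨S, hi, hj, hc, hl⟩ := hS i j hij
      refine ⟨S, hi, hj, hc, fun l hlS => ?_⟩
      obtain ⟨w, hw0, hw1, hw⟩ := exists_cert_aux (fun a => p (![i, j, l] a))
        (fun a => r (![i, j, l] a) ^ 2) (hl l hlS)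
      refine ⟨w, hw0, hw1, ?_⟩
      simp only [hn]
      have e1 : ∀ a b : Fin 3, w a * w b * (s ^ 2 * ‖p (![i, j, l] a) - p (![i, j, l] b)‖ ^ 2)
          = s ^ 2 * (w a * w b * ‖p (![i, j, l] a) - p (![i, j, l] b)‖ ^ 2) := by
        intros; ring
      have e2 : ∀ a : Fin 3, w a * (s ^ 2 * (r (![i, j, l] a) ^ 2 - ε))
          = s ^ 2 * (w a * r (![i, j, l] a) ^ 2) - w a * (s ^ 2 * ε) := by
        intros; ring
      simp only [e1, e2, Finset.sum_sub_distrib, ← Finset.mul_sum, ← Finset.sum_mul, hw1]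
      have := mul_nonneg (sq_nonneg s) hw
      linarith)
  simp only [hn, ← mul_sub, ← Finset.mul_sum] at h
  rw [scale_I (fun l => r l ^ 2 - ε) p s hs0, scale_I (fun l => r l ^ 2 - ε) q s hs0]
  have hsd : 0 < (s ^ d)⁻¹ := by positivity
  have hsd1 : (s ^ d)⁻¹ ≤ 1 := inv_le_one_of_one_le₀ (one_le_pow₀ hs)
  have h2 := mul_le_mul_of_nonneg_left h hsd.le
  rw [mul_sub] at h2
  set A := ∑ i, ∑ j, (‖q i - q j‖ ^ 2 - ‖p i - p j‖ ^ 2)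
  have h3 : (s ^ d)⁻¹ * (C * Real.exp (-(s ^ 2 * ε)) * (s ^ 2 * A))
      ≤ 1 * (C * Real.exp (-(s ^ 2 * ε)) * (s ^ 2 * A)) :=
    mul_le_mul_of_nonneg_right hsd1 (by positivity)
  linarith

open Filter Topology in
lemma vol_eps {N d : ℕ} [Nontrivial (E d)] (p q : Fin N → E d) (r : Fin N → ℝ)
    (hexp : ∀ i j, ‖p i - p j‖ ≤ ‖q i - q j‖)
    (hS : ∀ i j, i ≠ j → ∃ S : Finset (Fin N), i ∈ S ∧ j ∈ S ∧ S.card ≤ d + 3 ∧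
      ∀ l, l ∉ S → ¬ ∃ x, ∀ a : Fin 3, ‖x - p (![i, j, l] a)‖ ^ 2 < (r (![i, j, l] a)) ^ 2)
    (ε : ℝ) (hε : 0 < ε) :
    volume.real {y : E d | ∃ i, ‖y - p i‖ ^ 2 < r i ^ 2 - ε}
      ≤ volume.real {y : E d | ∃ i, ‖y - q i‖ ^ 2 < r i ^ 2 - ε} := by
  obtain ⟨C, hC, h⟩ := step_I p q r hexp hS ε
  have hk : Tendsto (fun k : ℕ => (k : ℝ) + 1) atTop atTop :=
    tendsto_atTop_add_const_right _ _ tendsto_natCast_atTop_atTop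
  have h0 : Tendsto (fun k : ℕ => C * (((k : ℝ) + 1) * Real.exp (-(((k : ℝ) + 1) * ε)))) atTop (𝓝 0) := by
    have h1 := (Real.tendsto_pow_mul_exp_neg_atTop_nhds_zero 1).comp (hk.atTop_mul_const hε)
    have h2 := h1.const_mul (C * ε⁻¹)
    simp only [mul_zero] at h2
    refine h2.congr fun k => ?_
    simp only [Function.comp_def, pow_one]
    field_simp
  have hl := (lim_I (fun l => r l ^ 2 - ε) p).sub h0
  rw [sub_zero] at hl
  refine le_of_tendsto_of_tendsto' hl (lim_I (fun l => r l ^ 2 - ε) q) fun k => ?_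
  have := h (Real.sqrt ((k : ℝ) + 1)) (by rw [Real.one_le_sqrt]; linarith [Nat.cast_nonneg (α := ℝ) k])
  rwa [Real.sq_sqrt (by positivity)] at this

open Filter Topology in
lemma vol_main {N d : ℕ} [Nontrivial (E d)] (p q : Fin N → E d) (r : Fin N → ℝ) (hr : ∀ i, 0 ≤ r i)
    (hexp : ∀ i j, ‖p i - p j‖ ≤ ‖q i - q j‖)
    (hS : ∀ i j, i ≠ j → ∃ S : Finset (Fin N), i ∈ S ∧ j ∈ S ∧ S.card ≤ d + 3 ∧
      ∀ l, l ∉ S → ¬ ∃ x, ∀ a : Fin 3, ‖x - p (![i, j, l] a)‖ ^ 2 < (r (![i, j, l] a)) ^ 2) :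
    volume (⋃ i, closedBall (p i) (r i)) ≤ volume (⋃ i, closedBall (q i) (r i)) := by
  have hsub : ∀ (v : Fin N → E d) (ε : ℝ), 0 < ε →
      {y : E d | ∃ i, ‖y - v i‖ ^ 2 < r i ^ 2 - ε} ⊆ ⋃ i, closedBall (v i) (r i) := by
    rintro v ε hε y ⟨i, hi⟩
    refine Set.mem_iUnion.2 ⟨i, ?_⟩
    rw [mem_closedBall, dist_eq_norm]
    exact abs_le_of_sq_le_sq' (by linarith) (hr i) |>.2
  have hfin : ∀ v : Fin N → E d, volume (⋃ i, closedBall (v i) (r i)) ≠ ⊤ := fun v =>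
    ((isCompact_iUnion fun i => isCompact_closedBall _ _).measure_lt_top).ne
  have hstep : ∀ k : ℕ, volume {y : E d | ∃ i, ‖y - p i‖ ^ 2 < r i ^ 2 - 1 / ((k : ℝ) + 1)}
      ≤ volume (⋃ i, closedBall (q i) (r i)) := by
    intro k
    have hk : 0 < 1 / ((k : ℝ) + 1) := by positivity
    refine le_trans ?_ (measure_mono (hsub q _ hk))
    refine (ENNReal.toReal_le_toReal (measure_ne_top_of_subset (hsub p _ hk) (hfin p))
      (measure_ne_top_of_subset (hsub q _ hk) (hfin q))).1 ?_
    exact vol_eps p q r hexp hS _ hk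
  have hmono : Monotone (fun k : ℕ => {y : E d | ∃ i, ‖y - p i‖ ^ 2 < r i ^ 2 - 1 / ((k : ℝ) + 1)}) := by
    rintro k m hkm y ⟨i, hi⟩
    refine ⟨i, hi.trans_le ?_⟩
    have : 1 / ((m : ℝ) + 1) ≤ 1 / ((k : ℝ) + 1) := Nat.one_div_le_one_div hkm
    linarith
  have hlim := le_of_tendsto' (tendsto_measure_iUnion_atTop (μ := volume) hmono) hstep
  refine le_trans ?_ hlim
  have hcov : (⋃ i, closedBall (p i) (r i)) ⊆
      (⋃ k : ℕ, {y : E d | ∃ i, ‖y - p i‖ ^ 2 < r i ^ 2 - 1 / ((k : ℝ) + 1)}) ∪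
      ⋃ i, sphere (p i) (r i) := by
    intro y hy
    obtain ⟨i, hi⟩ := Set.mem_iUnion.1 hy
    rw [mem_closedBall, dist_eq_norm] at hi
    rcases hi.lt_or_eq with h | h
    · left
      have h2 : 0 < r i ^ 2 - ‖y - p i‖ ^ 2 :=
        sub_pos.2 (pow_lt_pow_left₀ h (norm_nonneg _) two_ne_zero)
      obtain ⟨k, hk⟩ := exists_nat_one_div_lt h2
      exact Set.mem_iUnion.2 ⟨k, i, by linarith⟩
    · right
      exact Set.mem_iUnion.2 ⟨i, by rw [mem_sphere, dist_eq_norm, h]⟩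
  refine (measure_mono hcov).trans ((measure_union_le _ _).trans ?_)
  have : volume (⋃ i, sphere (p i) (r i)) = 0 :=
    measure_iUnion_null fun i => Measure.addHaar_sphere _ _ _
  rw [this, add_zero]

end KP

theorem kneser_poulsen_few_interior_intersections
    (d N : ℕ) (p q : Fin N → EuclideanSpace ℝ (Fin d)) (r : Fin N → ℝ)
    (hr : ∀ i, 0 ≤ r i)
    (hfew : ∀ i j : Fin N, i < j →
      Set.ncard {l : Fin N | l ≠ i ∧ l ≠ j ∧
        (interior (closedBall (p i) (r i)) ∩ interior (closedBall (p j) (r j)) ∩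
          interior (closedBall (p l) (r l))).Nonempty} ≤ d + 1)
    (hexp : ∀ i j : Fin N, i < j → dist (p i) (p j) ≤ dist (q i) (q j)) :
    volume (⋃ i, closedBall (p i) (r i)) ≤ volume (⋃ i, closedBall (q i) (r i)) := by
  rcases Nat.eq_zero_or_pos d with hd | hd
  · subst hd
    have : ∀ i, closedBall (p i) (r i) = closedBall (q i) (r i) := fun i => by
      rw [Subsingleton.elim (p i) (q i)]
    simp only [this, le_refl]
  haveI : Nonempty (Fin d) := ⟨⟨0, hd⟩⟩
  haveI : Nontrivial (KP.E d) := inferInstance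
  have hexp' : ∀ i j, ‖p i - p j‖ ≤ ‖q i - q j‖ := by
    intro i j
    rw [← dist_eq_norm, ← dist_eq_norm]
    rcases lt_trichotomy i j with h | h | h
    · exact hexp i j h
    · subst h; simp
    · rw [dist_comm, dist_comm (q i)]; exact hexp j i h
  have hfew' : ∀ i j, i ≠ j → Set.ncard {l : Fin N | l ≠ i ∧ l ≠ j ∧
        (interior (closedBall (p i) (r i)) ∩ interior (closedBall (p j) (r j)) ∩
          interior (closedBall (p l) (r l))).Nonempty} ≤ d + 1 := by
    intro i j hij
    rcases lt_or_gt_of_ne hij with h | h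
    · exact hfew i j h
    · convert hfew j i h using 3
      funext l
      rw [Set.inter_comm (interior (closedBall (p i) (r i)))]
      exact propext ⟨fun ⟨a, b, c⟩ => ⟨b, a, c⟩, fun ⟨a, b, c⟩ => ⟨b, a, c⟩⟩
  refine KP.vol_main p q r hr hexp' fun i j hij => ?_
  classical
  set T := {l : Fin N | l ≠ i ∧ l ≠ j ∧
        (interior (closedBall (p i) (r i)) ∩ interior (closedBall (p j) (r j)) ∩
          interior (closedBall (p l) (r l))).Nonempty} with hT
  refine ⟨insert i (insert j T.toFinset), by simp, by simp, ?_, fun l hl => ?_⟩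
  · have h1 : T.ncard ≤ d + 1 := hfew' i j hij
    rw [Set.ncard_eq_toFinset_card'] at h1
    have h2 := Finset.card_insert_le i (insert j T.toFinset)
    have h3 := Finset.card_insert_le j T.toFinset
    omega
  · simp only [Finset.mem_insert, Set.mem_toFinset, not_or] at hl
    rintro ⟨x, hx⟩
    apply hl.2.2
    have hin : ∀ k, ‖x - p k‖ ^ 2 < r k ^ 2 → x ∈ interior (closedBall (p k) (r k)) := by
      intro k hk
      apply ball_subset_interior_closedBall
      rw [mem_ball, dist_eq_norm]
      exact lt_of_pow_lt_pow_left₀ 2 (hr k) hk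
    exact ⟨hl.1, hl.2.1, x, ⟨hin i (hx 0), hin j (hx 1)⟩, hin l (hx 2)⟩
end
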